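/- arXiv:1409.4633 — 2 statements merged into one kernel-verified Lean document; each statement's English description precedes it below -/
import Mathlib

section
/- Global weighted Gagliardo–Nirenberg inequality. Fix integers n ≥ 2, m ≥ 1, a real p ≥ 1, and M > 0. There is a constant C > 0 depending only on n, m, p, M with the following property. Let Ω ⊂ ℝⁿ be a bounded open set, let Φ₀, Φ : ℝ^m → (0,∞) with Φ ∈ C¹ and k₁ := sup_y |DΦ(y)|/Φ(y) < ∞, k₂ := sup_y Φ(y)/Φ₀(y) < ∞. Let u ∈ C¹(Ω,ℝ^m) and U ∈ C²(Ω,ℝ^m), where U has compact support contained in Ω. Suppose the A_{p/(p+2)+1} constant of the weight (Φ∘u)^{2/(p+2)} on Ω is at most M. Set I₁ = ∫_Ω Φ(u)² |DU|^{2p+2} dx, Î₁ = ∫_Ω Φ(u)² |Du|^{2p+2} dx, and I₂ = ∫_Ω Φ₀(u)² |DU|^{2p−2} |D²U|² dx, and assume I₁, Î₁, I₂ are all finite. Then I₁ ≤ C ‖U‖_{BMO(Ω)} [ k₁(I₁ + Î₁) + k₂ I₁^{1/2} I₂^{1/2} ]. -/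
open MeasureTheory Metric

/-- The set of mean oscillations of `v` over sets `Ω ∩ B(x₀,R)` with `x₀ ∈ Ω`, `R > 0`. -/
noncomputable def oscSet {n : ℕ} {E : Type*} [NormedAddCommGroup E] [NormedSpace ℝ E]
    (Ω : Set (EuclideanSpace ℝ (Fin n))) (v : EuclideanSpace ℝ (Fin n) → E) : Set ℝ :=
  { a | ∃ x₀ ∈ Ω, ∃ R : ℝ, 0 < R ∧
      a = ⨍ x in Ω ∩ ball x₀ R, ‖v x - ⨍ y in Ω ∩ ball x₀ R, v y‖ }

/-- The BMO seminorm `[v]_{BMO(Ω)}`. -/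
noncomputable def bmoSeminorm {n : ℕ} {E : Type*} [NormedAddCommGroup E] [NormedSpace ℝ E]
    (Ω : Set (EuclideanSpace ℝ (Fin n))) (v : EuclideanSpace ℝ (Fin n) → E) : ℝ :=
  sSup (oscSet Ω v)

/-- The BMO norm `‖v‖_{BMO(Ω)} = ‖v‖_{L¹(Ω)} + [v]_{BMO(Ω)}`. -/
noncomputable def bmoNorm {n : ℕ} {E : Type*} [NormedAddCommGroup E] [NormedSpace ℝ E]
    (Ω : Set (EuclideanSpace ℝ (Fin n))) (v : EuclideanSpace ℝ (Fin n) → E) : ℝ :=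
  (∫ x in Ω, ‖v x‖) + bmoSeminorm Ω v

/-- The set of the `A_γ` quantities `(⨍_B w) (⨍_B w^{1-γ'})^{γ-1}` over balls `B ⊆ Ω`,
where `γ' = γ/(γ-1)`. -/
noncomputable def apSet {n : ℕ} (Ω : Set (EuclideanSpace ℝ (Fin n))) (γ : ℝ)
    (w : EuclideanSpace ℝ (Fin n) → ℝ) : Set ℝ :=
  { a | ∃ x₀ : EuclideanSpace ℝ (Fin n), ∃ R : ℝ, 0 < R ∧ ball x₀ R ⊆ Ω ∧
      a = (⨍ y in ball x₀ R, w y) *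
          (⨍ y in ball x₀ R, w y ^ (1 - γ / (γ - 1))) ^ (γ - 1) }

/-- dyadic centered maximal function -/
noncomputable def gnMax {n : ℕ} (H : EuclideanSpace ℝ (Fin n) → ENNReal)
    (x : EuclideanSpace ℝ (Fin n)) : ENNReal :=
  ⨆ k : ℤ, (∫⁻ y in closedBall x ((2:ℝ) ^ k), H y) / volume (closedBall x ((2:ℝ) ^ k))

lemma gnMax_measurable {n : ℕ} (H : EuclideanSpace ℝ (Fin n) → ENNReal) (hH : Measurable H) :
    Measurable (gnMax H) := by
  unfold gnMax
  refine Measurable.iSup fun k => ?_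
  have hv : ∀ x : EuclideanSpace ℝ (Fin n), volume (closedBall x ((2:ℝ) ^ k))
      = volume (closedBall (0 : EuclideanSpace ℝ (Fin n)) ((2:ℝ) ^ k)) := fun x =>
    Measure.addHaar_closedBall_center _ _ _
  simp_rw [hv]
  refine Measurable.div_const ?_ _
  have h2 : ∀ x : EuclideanSpace ℝ (Fin n), ∫⁻ y in closedBall x ((2:ℝ) ^ k), H y
      = ∫⁻ y, ({q : EuclideanSpace ℝ (Fin n) × EuclideanSpace ℝ (Fin n) |
          dist q.2 q.1 ≤ (2:ℝ)^k}.indicator (fun q => H q.2) (x, y)) := by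
    intro x
    rw [← lintegral_indicator measurableSet_closedBall]
    rfl
  simp_rw [h2]
  apply Measurable.lintegral_prod_right'
    (f := ({q : EuclideanSpace ℝ (Fin n) × EuclideanSpace ℝ (Fin n) |
          dist q.2 q.1 ≤ (2:ℝ)^k}.indicator (fun q => H q.2)))
  refine Measurable.indicator (hH.comp measurable_snd) ?_
  exact (isClosed_le (by fun_prop) (by fun_prop)).measurableSet

lemma gnMax_weak {n : ℕ} (hn : 2 ≤ n) (H : EuclideanSpace ℝ (Fin n) → ENNReal)
    (hi : ∫⁻ y, H y ≠ ⊤) (l : ENNReal) (hl : l ≠ 0) (hl' : l ≠ ⊤) :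
    l * volume {x | l < gnMax H x} ≤ 4 ^ n * ∫⁻ y, H y := by
  classical
  have : Nonempty (Fin n) := ⟨⟨0, by omega⟩⟩
  set S := {x | l < gnMax H x} with hS
  have h1 : ∀ x ∈ S, ∃ k : ℤ, l * volume (closedBall x ((2:ℝ) ^ k))
      < ∫⁻ y in closedBall x ((2:ℝ) ^ k), H y := by
    intro x hx
    have hx : l < gnMax H x := hx
    obtain ⟨k, hk⟩ := lt_iSup_iff.1 hx
    refine ⟨k, ?_⟩
    have hpos : volume (closedBall x ((2:ℝ) ^ k)) ≠ 0 :=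
      (measure_closedBall_pos _ _ (by positivity)).ne'
    rwa [ENNReal.lt_div_iff_mul_lt (Or.inl hpos) (Or.inl measure_closedBall_lt_top.ne)] at hk
  choose! k hk using h1
  -- radii bounded
  have hb : ∃ R : ℝ, ∀ x ∈ S, (2:ℝ) ^ (k x) ≤ R := by
    set V := volume (ball (0 : EuclideanSpace ℝ (Fin n)) 1) with hV
    have hV0 : V ≠ 0 := (measure_ball_pos _ _ one_pos).ne'
    have hV1 : V ≠ ⊤ := measure_ball_lt_top.ne
    refine ⟨max 1 ((∫⁻ y, H y) / (l * V)).toReal, fun x hx => ?_⟩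
    by_cases h : (2:ℝ) ^ (k x) ≤ 1
    · exact h.trans (le_max_left _ _)
    refine le_max_of_le_right ?_
    push Not at h
    have h3 := (hk x hx).le.trans (setLIntegral_le_lintegral _ _)
    rw [Measure.addHaar_closedBall _ _ (by positivity), finrank_euclideanSpace_fin, ← hV] at h3
    have h4 : ENNReal.ofReal ((2:ℝ) ^ (k x)) ≤ (∫⁻ y, H y) / (l * V) := by
      rw [ENNReal.le_div_iff_mul_le (Or.inl (mul_ne_zero hl hV0)) (Or.inl (ENNReal.mul_ne_top hl' hV1))]
      refine le_trans ?_ h3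
      calc ENNReal.ofReal ((2:ℝ) ^ (k x)) * (l * V) = l * (ENNReal.ofReal ((2:ℝ) ^ (k x)) * V) := by ring
        _ ≤ _ := by
          gcongr
          calc (2:ℝ) ^ (k x) = ((2:ℝ) ^ (k x)) ^ 1 := by simp
            _ ≤ _ := pow_le_pow_right₀ h.le (by omega)
    rw [ENNReal.ofReal_le_iff_le_toReal] at h4
    · exact h4
    · exact ENNReal.div_ne_top hi (mul_ne_zero hl hV0)
  obtain ⟨R, hR⟩ := hb
  obtain ⟨u, hut, hdisj, hcov⟩ := Vitali.exists_disjoint_subfamily_covering_enlargement_closedBall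
    S (fun x => x) (fun x => (2:ℝ) ^ (k x)) R hR 4 (by norm_num)
  have hcount : u.Countable := by
    refine hdisj.countable_of_nonempty_interior fun a ha => ?_
    rw [interior_closedBall _ (by positivity)]
    exact ⟨a, mem_ball_self (by positivity)⟩
  have hSsub : S ⊆ ⋃ b ∈ u, closedBall b (4 * (2:ℝ) ^ (k b)) := by
    intro x hx
    obtain ⟨b, hbu, hb⟩ := hcov x hx
    exact Set.mem_biUnion hbu (hb (mem_closedBall_self (by positivity)))
  calc l * volume S ≤ l * ∑' b : u, volume (closedBall (b : EuclideanSpace ℝ (Fin n)) (4 * (2:ℝ) ^ (k b))) := by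
        gcongr
        exact (measure_mono hSsub).trans (measure_biUnion_le _ hcount _)
    _ = 4 ^ n * ∑' b : u, l * volume (closedBall (b : EuclideanSpace ℝ (Fin n)) ((2:ℝ) ^ (k b))) := by
        rw [← ENNReal.tsum_mul_left, ← ENNReal.tsum_mul_left]
        congr 1; ext b
        rw [Measure.addHaar_closedBall_mul _ _ (by norm_num) (by positivity),
          finrank_euclideanSpace_fin, Measure.addHaar_closedBall_center _ (b : EuclideanSpace ℝ (Fin n)), 
          ENNReal.ofReal_pow (by norm_num)]
        norm_num
        ring
    _ ≤ 4 ^ n * ∑' b : u, ∫⁻ y in closedBall (b : EuclideanSpace ℝ (Fin n)) ((2:ℝ) ^ (k b)), H y := by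
        gcongr with b
        exact (hk b (hut b.2)).le
    _ = 4 ^ n * ∫⁻ y in ⋃ b ∈ u, closedBall (b : EuclideanSpace ℝ (Fin n)) ((2:ℝ) ^ (k b)), H y := by
        rw [lintegral_biUnion hcount (fun _ _ => measurableSet_closedBall) hdisj]
    _ ≤ _ := by gcongr; exact Measure.restrict_le_self

lemma gnMax_weak2 {n : ℕ} (hn : 2 ≤ n) (H : EuclideanSpace ℝ (Fin n) → ENNReal) (hH : Measurable H)
    (hi : ∫⁻ y, H y ≠ ⊤) (l : ENNReal) (hl : l ≠ 0) (hl' : l ≠ ⊤) :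
    l * volume {x | 2 * l < gnMax H x} ≤ 4 ^ n * ∫⁻ y in {y | l < H y}, H y := by
  have : Nonempty (Fin n) := ⟨⟨0, by omega⟩⟩
  have hm : MeasurableSet {y | l < H y} := measurableSet_lt measurable_const hH
  rw [← lintegral_indicator hm]
  refine le_trans ?_ (gnMax_weak hn _ ?_ l hl hl')
  · refine mul_le_mul_right (measure_mono ?_) _
    intro x hx
    have hx : 2 * l < gnMax H x := hx
    change l < gnMax _ x
    obtain ⟨k, hk⟩ := lt_iSup_iff.1 hx
    refine lt_of_lt_of_le ?_ (le_iSup _ k)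
    have hpos : volume (closedBall x ((2:ℝ) ^ k)) ≠ 0 :=
      (measure_closedBall_pos _ _ (by positivity)).ne'
    have hfin : volume (closedBall x ((2:ℝ) ^ k)) ≠ ⊤ := measure_closedBall_lt_top.ne
    rw [ENNReal.lt_div_iff_mul_lt (Or.inl hpos) (Or.inl hfin)] at hk ⊢
    have h5 : ∫⁻ y in closedBall x ((2:ℝ) ^ k), H y ≤
        (∫⁻ y in closedBall x ((2:ℝ) ^ k), ({y | l < H y}.indicator H y)) + l * volume (closedBall x ((2:ℝ) ^ k)) := by
      rw [← setLIntegral_const, ← lintegral_add_left (hH.indicator hm)]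
      gcongr with y
      by_cases h : l < H y
      · simp [Set.indicator, h]
      · simp [Set.indicator, h]; exact not_lt.1 h
    have h6 := hk.trans_le h5
    rw [two_mul, add_mul] at h6
    exact (ENNReal.add_lt_add_iff_right (ENNReal.mul_ne_top hl' hfin)).1 h6
  · refine ne_top_of_le_ne_top hi (lintegral_mono fun y => Set.indicator_le_self _ _ _)

lemma gnMax_ae_ne_top {n : ℕ} (hn : 2 ≤ n) (H : EuclideanSpace ℝ (Fin n) → ENNReal)
    (hi : ∫⁻ y, H y ≠ ⊤) : ∀ᵐ x, gnMax H x ≠ ⊤ := by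
  rw [ae_iff]
  simp only [not_not]
  by_contra h
  have h1 : ∀ j : ℕ, ((j:ENNReal)+1) * volume {x | gnMax H x = ⊤} ≤ 4 ^ n * ∫⁻ y, H y := by
    intro j
    refine le_trans ?_ (gnMax_weak hn H hi ((j:ENNReal)+1) (by simp) (by simp))
    gcongr with x
    intro hx
    rw [hx]; exact ENNReal.add_lt_top.2 ⟨by simp, by simp⟩
  have hfin : (4:ENNReal) ^ n * ∫⁻ y, H y ≠ ⊤ := ENNReal.mul_ne_top (by simp) hi
  obtain ⟨j, hj⟩ := ENNReal.exists_nat_mul_gt h hfin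
  have := h1 j
  rw [add_mul] at this
  exact absurd (hj.trans_le (le_self_add.trans this)) (lt_irrefl _)

lemma gnMax_L2 {n : ℕ} (hn : 2 ≤ n) (H : EuclideanSpace ℝ (Fin n) → ENNReal) (hH : Measurable H)
    (hi : ∫⁻ y, H y ≠ ⊤) :
    ∫⁻ x, (gnMax H x) ^ 2 ≤ 8 * 4 ^ n * ∫⁻ y, (H y) ^ 2 := by
  have hMm := gnMax_measurable H hH
  have h1 : ∫⁻ x, (gnMax H x) ^ 2 = ∫⁻ x, ENNReal.ofReal (((gnMax H x).toReal) ^ (2:ℝ)) := by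
    refine lintegral_congr_ae ?_
    filter_upwards [gnMax_ae_ne_top hn H hi] with x hx
    rw [Real.rpow_two, ENNReal.ofReal_pow (by positivity), ENNReal.ofReal_toReal hx]
  rw [h1, lintegral_rpow_eq_lintegral_meas_lt_mul _ (Filter.Eventually.of_forall fun x => by simp) hMm.ennreal_toReal.aemeasurable (by norm_num)]
  have h2 : ∀ t ∈ Set.Ioi (0:ℝ), volume {a | t < (gnMax H a).toReal} * ENNReal.ofReal (t ^ ((2:ℝ) - 1))
      ≤ 2 * 4 ^ n * ∫⁻ y, {q : ℝ × EuclideanSpace ℝ (Fin n) | ENNReal.ofReal (q.1 / 2) < H q.2}.indicator (fun q => H q.2) (t, y) := by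
    intro t ht
    have ht : 0 < t := ht
    have h3 := gnMax_weak2 hn H hH hi (ENNReal.ofReal (t/2)) (by simpa using ht) (by simp)
    have h4 : (2:ENNReal) * ENNReal.ofReal (t/2) = ENNReal.ofReal t := by
      rw [show (2:ENNReal) = ENNReal.ofReal 2 by simp, ← ENNReal.ofReal_mul (by norm_num)]
      congr 1; ring
    rw [h4, ← lintegral_indicator (measurableSet_lt measurable_const hH)] at h3
    calc _ ≤ volume {x | ENNReal.ofReal t < gnMax H x} * ENNReal.ofReal t := by
          rw [show (2:ℝ) - 1 = 1 by norm_num, Real.rpow_one]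
          gcongr with a
          intro ha
          exact (ENNReal.ofReal_lt_iff_lt_toReal ht.le (by rintro h; simp [h] at ha; linarith)).2 ha
      _ = 2 * (ENNReal.ofReal (t/2) * volume {x | ENNReal.ofReal t < gnMax H x}) := by
          rw [← h4]; ring
      _ ≤ 2 * (4 ^ n * _) := by gcongr
      _ = _ := by rw [mul_assoc]; rfl
  have hmeas : Measurable ({q : ℝ × EuclideanSpace ℝ (Fin n) | ENNReal.ofReal (q.1 / 2) < H q.2}.indicator (fun q => H q.2)) := by
    refine Measurable.indicator (hH.comp measurable_snd) ?_
    exact measurableSet_lt (by fun_prop) (hH.comp measurable_snd)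
  calc _ ≤ ENNReal.ofReal 2 * ∫⁻ t in Set.Ioi (0:ℝ), 2 * 4 ^ n * ∫⁻ y, {q : ℝ × EuclideanSpace ℝ (Fin n) | ENNReal.ofReal (q.1 / 2) < H q.2}.indicator (fun q => H q.2) (t, y) := by
        gcongr 1
        exact setLIntegral_mono' measurableSet_Ioi h2
    _ = ENNReal.ofReal 2 * (2 * 4 ^ n * ∫⁻ y, ∫⁻ t in Set.Ioi (0:ℝ), {q : ℝ × EuclideanSpace ℝ (Fin n) | ENNReal.ofReal (q.1 / 2) < H q.2}.indicator (fun q => H q.2) (t, y)) := by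
        rw [lintegral_const_mul _ hmeas.lintegral_prod_right', lintegral_lintegral_swap (f := fun t y => {q : ℝ × EuclideanSpace ℝ (Fin n) | ENNReal.ofReal (q.1 / 2) < H q.2}.indicator (fun q => H q.2) (t, y)) hmeas.aemeasurable]
    _ ≤ ENNReal.ofReal 2 * (2 * 4 ^ n * ∫⁻ y, 2 * (H y) ^ 2) := by
        gcongr with y
        by_cases hy : H y = ⊤
        · simp [hy]
        have : ∀ t : ℝ, {q : ℝ × EuclideanSpace ℝ (Fin n) | ENNReal.ofReal (q.1 / 2) < H q.2}.indicator (fun q => H q.2) (t, y)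
            ≤ (Set.Iio (2 * (H y).toReal)).indicator (fun _ => H y) t := by
          intro t
          by_cases h : ENNReal.ofReal (t/2) < H y
          · have : t < 2 * (H y).toReal := by
              by_cases ht : 0 ≤ t
              · have := (ENNReal.ofReal_lt_iff_lt_toReal (by linarith) hy).1 h; linarith
              · have : 0 ≤ (H y).toReal := by positivity
                linarith
            simp [Set.indicator, h, this]
          · simp [Set.indicator, h]
        calc _ ≤ ∫⁻ t in Set.Ioi (0:ℝ), (Set.Iio (2 * (H y).toReal)).indicator (fun _ => H y) t := lintegral_mono fun t => this t
          _ = H y * ENNReal.ofReal (2 * (H y).toReal) := by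
            rw [lintegral_indicator measurableSet_Iio, setLIntegral_const, Measure.restrict_apply measurableSet_Iio, Set.inter_comm, Set.Ioi_inter_Iio]
            simp
          _ = 2 * (H y) ^ 2 := by
            rw [ENNReal.ofReal_mul (by norm_num), ENNReal.ofReal_toReal hy]; simp; ring
          _ ≤ _ := le_rfl
    _ = _ := by
        rw [lintegral_const_mul _ (hH.pow_const _)]
        simp; ring


lemma gn_cov {n : ℕ} (g : EuclideanSpace ℝ (Fin n) → ℝ) (x : EuclideanSpace ℝ (Fin n)) {t : ℝ}
    (ht : 0 < t) :
    ∫ z in ball (0 : EuclideanSpace ℝ (Fin n)) 1, g (x + t • z)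
      = (t ^ n)⁻¹ * ∫ y in ball x t, g y := by
  have h1 := Measure.setIntegral_comp_smul_of_pos (volume : Measure (EuclideanSpace ℝ (Fin n)))
    (fun y => g (x + y)) (ball 0 1) ht
  rw [h1, finrank_euclideanSpace_fin, smul_eq_mul, smul_unitBall_of_pos ht]
  congr 1
  have h2 := (measurePreserving_add_left (volume : Measure (EuclideanSpace ℝ (Fin n))) x).setIntegral_preimage_emb
    (measurableEmbedding_addLeft x) g (ball x t)
  rw [← h2]
  congr 2
  ext y; simp

lemma gn_vol {n : ℕ} (x : EuclideanSpace ℝ (Fin n)) {t : ℝ} (ht : 0 < t) :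
    volume.real (ball x t) = t ^ n * volume.real (ball (0 : EuclideanSpace ℝ (Fin n)) 1) := by
  rw [measureReal_def, Measure.addHaar_ball_of_pos _ _ ht, finrank_euclideanSpace_fin,
    ENNReal.toReal_mul, ENNReal.toReal_ofReal (by positivity), measureReal_def]

lemma gn_poincare {n : ℕ} (ζ : EuclideanSpace ℝ (Fin n) → ℝ) (hζ : ContDiff ℝ 1 ζ)
    (hc : HasCompactSupport ζ) (x : EuclideanSpace ℝ (Fin n)) (A : ℝ)
    (hN : ∀ ρ > 0, ∫ y in ball x ρ, ‖fderiv ℝ ζ y‖ ≤ A * volume.real (ball x ρ))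
    {r : ℝ} (hr : 0 < r) :
    ζ x * volume.real (ball x r) - r * A * volume.real (ball x r) ≤ ∫ y in ball x r, ζ y := by
  have hd : Differentiable ℝ ζ := hζ.differentiable (by norm_num)
  have hfc : Continuous (fderiv ℝ ζ) := hζ.continuous_fderiv (by norm_num)
  obtain ⟨D, hD⟩ := hfc.bounded_above_of_compact_support (hc.fderiv ℝ)
  set V := volume.real (ball (0 : EuclideanSpace ℝ (Fin n)) 1) with hV
  set F : ℝ → ℝ := fun t => ∫ z in ball (0 : EuclideanSpace ℝ (Fin n)) 1, ζ (x + t • z) with hF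
  have hder : ∀ t, HasDerivAt F (∫ z in ball (0 : EuclideanSpace ℝ (Fin n)) 1, fderiv ℝ ζ (x + t • z) z) t := by
    intro t
    have hci : ∀ t : ℝ, Continuous fun z => ζ (x + t • z) := fun t =>
      hζ.continuous.comp (by fun_prop)
    refine (hasDerivAt_integral_of_dominated_loc_of_deriv_le (μ := volume.restrict (ball (0 : EuclideanSpace ℝ (Fin n)) 1))
      (F := fun t z => ζ (x + t • z)) (F' := fun t z => fderiv ℝ ζ (x + t • z) z)
      (s := Set.univ) (bound := fun _ => D) Filter.univ_mem ?_ ?_ ?_ ?_ ?_ ?_).2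
    · exact Filter.Eventually.of_forall fun t => (hci t).aestronglyMeasurable
    · exact ((hci t).continuousOn.integrableOn_compact (isCompact_closedBall 0 1)).mono_set ball_subset_closedBall
    · refine Continuous.aestronglyMeasurable ?_
      exact (hfc.comp (by fun_prop)).clm_apply continuous_id
    · filter_upwards [ae_restrict_mem measurableSet_ball] with z hz t _
      have hz : ‖z‖ ≤ 1 := by simpa using (mem_ball.1 hz).le
      calc _ ≤ ‖fderiv ℝ ζ (x + t • z)‖ * ‖z‖ := ContinuousLinearMap.le_opNorm _ _
        _ ≤ ‖fderiv ℝ ζ (x + t • z)‖ * 1 := by gcongr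
        _ ≤ D := by rw [mul_one]; exact hD _
    · exact integrableOn_const measure_ball_lt_top.ne
    · refine Filter.Eventually.of_forall fun z t _ => ?_
      have h1 : HasDerivAt (fun t : ℝ => x + t • z) z t := by
        simpa using ((hasDerivAt_id t).smul_const z).const_add x
      exact (hd _).hasFDerivAt.comp_hasDerivAt t h1
  have hbd : ∀ t > 0, -(A * V) ≤ deriv F t := by
    intro t ht
    rw [(hder t).deriv]
    have h1 : ‖∫ z in ball (0 : EuclideanSpace ℝ (Fin n)) 1, fderiv ℝ ζ (x + t • z) z‖ ≤
        ∫ z in ball (0 : EuclideanSpace ℝ (Fin n)) 1, ‖fderiv ℝ ζ (x + t • z)‖ := by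
      refine norm_integral_le_of_norm_le ?_ ?_
      · refine (Continuous.continuousOn ?_).integrableOn_compact (isCompact_closedBall (0 : EuclideanSpace ℝ (Fin n)) 1) |>.mono_set ball_subset_closedBall
        exact (hfc.comp (by fun_prop)).norm
      · filter_upwards [ae_restrict_mem measurableSet_ball] with z hz
        have hz : ‖z‖ ≤ 1 := by simpa using (mem_ball.1 hz).le
        calc _ ≤ ‖fderiv ℝ ζ (x + t • z)‖ * ‖z‖ := ContinuousLinearMap.le_opNorm _ _
          _ ≤ ‖fderiv ℝ ζ (x + t • z)‖ * 1 := by gcongr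
          _ = _ := mul_one _
    rw [gn_cov (fun y => ‖fderiv ℝ ζ y‖) x ht] at h1
    have h2 := hN t ht
    rw [gn_vol x ht] at h2
    have h3 : (t ^ n)⁻¹ * ∫ y in ball x t, ‖fderiv ℝ ζ y‖ ≤ A * V := by
      rw [inv_mul_le_iff₀ (by positivity)]
      linarith
    have := neg_le_of_abs_le (h1.trans h3)
    exact this
  have hmv := (convex_Icc (0:ℝ) r).mul_sub_le_image_sub_of_le_deriv (f := F) (C := -(A*V))
    (fun t _ => (hder t).continuousAt.continuousWithinAt)
    (fun t _ => (hder t).differentiableAt.differentiableWithinAt)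
    (fun t ht => hbd t (by rw [interior_Icc] at ht; exact ht.1))
    0 ⟨le_rfl, hr.le⟩ r ⟨hr.le, le_rfl⟩ hr.le
  have hF0 : F 0 = ζ x * V := by
    simp [hF, hV, mul_comm]
  have hFr : F r = (r ^ n)⁻¹ * ∫ y in ball x r, ζ y := gn_cov ζ x hr
  rw [hF0, hFr] at hmv
  rw [gn_vol x hr, ← hV]
  have hrn : 0 < r ^ n := by positivity
  have e : ∫ y in ball x r, ζ y = r ^ n * ((r ^ n)⁻¹ * ∫ y in ball x r, ζ y) := by
    field_simp
  rw [e]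
  nlinarith

lemma gn_arctan_aux (z : ℝ) : 1 - |z| ≤ 1 / (1 + z ^ 2) := by
  rw [le_div_iff₀ (by positivity), ← sq_abs z]
  have := abs_nonneg z
  nlinarith [mul_nonneg this (sq_nonneg (|z| - 1)), sq_nonneg (|z|)]

lemma gn_local (n : ℕ) : ∃ C > 0, ∀ (m : ℕ) (Ω : Set (EuclideanSpace ℝ (Fin n))), IsOpen Ω →
    ∀ (U : EuclideanSpace ℝ (Fin n) → EuclideanSpace ℝ (Fin m)), ContDiff ℝ 1 U →
    ∀ (β : ℝ), 0 < β → ∀ x ∈ Ω,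
    (∀ R > 0, ⨍ z in Ω ∩ ball x R, ‖U z - ⨍ y in Ω ∩ ball x R, U y‖ ≤ β) →
    ∀ (ζ : EuclideanSpace ℝ (Fin n) → ℝ), ContDiff ℝ 1 ζ → HasCompactSupport ζ →
    (∀ y, ζ y ≠ 0 → y ∈ Ω) → (∀ y, 0 ≤ ζ y) → (∀ y, ζ y ≤ 1) → ζ x = 1 →
    ∀ (A : ℝ), 0 < A →
    (∀ ρ > 0, ∫ y in ball x ρ, ‖fderiv ℝ ζ y‖ ≤ A * volume.real (ball x ρ)) →
    ∀ (ℓ : EuclideanSpace ℝ (Fin m) →L[ℝ] ℝ) (v : EuclideanSpace ℝ (Fin n)), ‖ℓ‖ ≤ 1 → ‖v‖ ≤ 1 →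
    ∀ σ : ℝ, 0 ≤ σ → (∀ y, ζ y ≠ 0 → σ ≤ ℓ (fderiv ℝ U y v)) → σ ≤ C * β * A := by
  let φ₀ : ContDiffBump (0 : EuclideanSpace ℝ (Fin n)) := ⟨1, 2, by norm_num, by norm_num⟩
  have hφ₀ : ContDiff ℝ 1 φ₀ := φ₀.contDiff
  obtain ⟨D, hD⟩ := (hφ₀.continuous_fderiv (by norm_num)).bounded_above_of_compact_support
    (φ₀.hasCompactSupport.fderiv ℝ)
  have hD0 : 0 ≤ D := (norm_nonneg _).trans (hD 0)
  refine ⟨16 * 3 ^ n * (1 + 4 * D), by positivity, ?_⟩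
  intro m Ω hΩ U hU β hβ x hx hosc ζ hζ hζc hζΩ hζ0 hζ1 hζx A hA hN ℓ v hℓ hv σ hσ hσs
  set r := 1 / (4 * A) with hr
  have hr0 : 0 < r := by positivity
  have hrA : r * A = 1 / 4 := by rw [hr]; field_simp
  set φ : EuclideanSpace ℝ (Fin n) → ℝ := fun y => φ₀ (r⁻¹ • (y - x)) with hφ
  have hφC : ContDiff ℝ 1 φ := hφ₀.comp (by fun_prop)
  have hφd : ∀ y, HasFDerivAt φ ((fderiv ℝ φ₀ (r⁻¹ • (y - x))).comp (r⁻¹ • ContinuousLinearMap.id ℝ _)) y := by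
    intro y
    refine HasFDerivAt.comp (g := φ₀) (f := fun y => r⁻¹ • (y - x)) y
      (hφ₀.differentiable (by norm_num) _).hasFDerivAt ?_
    exact ((hasFDerivAt_id y).sub_const x).const_smul r⁻¹
  have hφ01 : ∀ y, 0 ≤ φ y := fun y => φ₀.nonneg
  have hφ1 : ∀ y, φ y ≤ 1 := fun y => φ₀.le_one
  have hφin : ∀ y ∈ ball x r, φ y = 1 := by
    intro y hy
    refine φ₀.one_of_mem_closedBall ?_
    rw [mem_closedBall_zero_iff, norm_smul, norm_inv, Real.norm_of_nonneg hr0.le,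
      inv_mul_le_iff₀ hr0]
    have := mem_ball_iff_norm.1 hy
    change ‖y - x‖ ≤ r * 1
    linarith
  have hbig : ∀ y, y ∉ ball x (3 * r) → r⁻¹ • (y - x) ∉ tsupport φ₀ := by
    intro y hy h
    rw [φ₀.tsupport_eq, mem_closedBall_zero_iff, norm_smul, norm_inv, Real.norm_of_nonneg hr0.le,
      inv_mul_le_iff₀ hr0] at h
    rw [mem_ball_iff_norm] at hy
    have h : ‖y - x‖ ≤ r * 2 := h
    linarith
  have hφout : ∀ y, y ∉ ball x (3 * r) → φ y = 0 := fun y hy =>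
    image_eq_zero_of_notMem_tsupport (f := φ₀) (hbig y hy)
  have hDφ : ∀ y, ‖fderiv ℝ φ y‖ ≤ (ball x (3 * r)).indicator (fun _ => D / r) y := by
    intro y
    rw [(hφd y).fderiv]
    by_cases hy : y ∈ ball x (3 * r)
    · rw [Set.indicator_of_mem hy]
      calc _ ≤ ‖fderiv ℝ φ₀ (r⁻¹ • (y - x))‖ * ‖r⁻¹ • ContinuousLinearMap.id ℝ (EuclideanSpace ℝ (Fin n))‖ :=
            ContinuousLinearMap.opNorm_comp_le _ _
        _ ≤ D * r⁻¹ := by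
          gcongr
          · exact hD _
          · rw [norm_smul, norm_inv, Real.norm_of_nonneg hr0.le]
            exact mul_le_of_le_one_right (by positivity) ContinuousLinearMap.norm_id_le
        _ = _ := by rw [div_eq_mul_inv]
    · rw [Set.indicator_of_notMem hy]
      have : fderiv ℝ φ₀ (r⁻¹ • (y - x)) = 0 := by
        by_contra h
        exact hbig y hy (support_fderiv_subset ℝ h)
      simp [this]
  set w : EuclideanSpace ℝ (Fin n) → ℝ := fun y => ζ y * φ y with hw
  have hwC : ContDiff ℝ 1 w := hζ.mul hφC
  have hwc : HasCompactSupport w := hζc.mul_right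
  have hζd : Differentiable ℝ ζ := hζ.differentiable (by norm_num)
  have hDw : ∀ y, ‖fderiv ℝ w y‖ ≤ (ball x (3 * r)).indicator (fun y => ‖fderiv ℝ ζ y‖ + D / r) y := by
    intro y
    have e : fderiv ℝ w y = ζ y • fderiv ℝ φ y + φ y • fderiv ℝ ζ y :=
      fderiv_fun_mul (hζd y) (hφd y).differentiableAt
    rw [e]
    have h1 : ‖ζ y • fderiv ℝ φ y + φ y • fderiv ℝ ζ y‖ ≤ ζ y * ‖fderiv ℝ φ y‖ + φ y * ‖fderiv ℝ ζ y‖ := by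
      refine (norm_add_le _ _).trans ?_
      rw [norm_smul, norm_smul, Real.norm_of_nonneg (hζ0 y), Real.norm_of_nonneg (hφ01 y)]
    have h2 := hDφ y
    by_cases hy : y ∈ ball x (3 * r)
    · rw [Set.indicator_of_mem hy] at h2 ⊢
      nlinarith [hζ0 y, hζ1 y, hφ01 y, hφ1 y, norm_nonneg (fderiv ℝ ζ y), norm_nonneg (fderiv ℝ φ y)]
    · rw [Set.indicator_of_notMem hy] at h2 ⊢
      rw [hφout y hy] at h1
      have : ‖fderiv ℝ φ y‖ = 0 := le_antisymm h2 (norm_nonneg _)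
      rw [this] at h1
      rw [hφout y hy]
      linarith
  set c := ⨍ y in Ω ∩ ball x r, U y with hcdef
  set K := 4 * β with hK
  have hK0 : 0 < K := by positivity
  set V : EuclideanSpace ℝ (Fin n) → ℝ := fun y => ℓ (U y - c) with hV
  have hVC : ContDiff ℝ 1 V := ℓ.contDiff.comp (hU.sub contDiff_const)
  set f : EuclideanSpace ℝ (Fin n) → ℝ := fun y => K * Real.arctan (V y / K) with hf
  have hUd : Differentiable ℝ U := hU.differentiable (by norm_num)
  have hfC : ContDiff ℝ 1 f := contDiff_const.mul (Real.contDiff_arctan.comp (hVC.div_const K))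
  have hVd : ∀ y, HasFDerivAt V (ℓ.comp (fderiv ℝ U y)) y := fun y =>
    ℓ.hasFDerivAt.comp y ((hUd y).hasFDerivAt.sub_const c)
  have hfd : ∀ y, fderiv ℝ f y v = 1 / (1 + (V y / K) ^ 2) * ℓ (fderiv ℝ U y v) := by
    intro y
    have h1 : HasFDerivAt (fun y => V y / K) (K⁻¹ • ℓ.comp (fderiv ℝ U y)) y := by
      have := (hVd y).const_mul K⁻¹
      simpa only [div_eq_inv_mul] using this
    have h2 := (h1.arctan).const_mul K
    rw [h2.fderiv]
    simp only [smul_apply, ContinuousLinearMap.comp_apply, smul_eq_mul]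
    field_simp
  have hint1 : Integrable (fun y => fderiv ℝ f y v * w y) := by
    refine Continuous.integrable_of_hasCompactSupport ?_ hwc.mul_left
    exact ((hfC.continuous_fderiv (by norm_num)).clm_apply continuous_const).mul hwC.continuous
  have hwvc : HasCompactSupport (fun y => fderiv ℝ w y v) := by
    refine (hwc.fderiv ℝ).comp_left (g := fun (L : EuclideanSpace ℝ (Fin n) →L[ℝ] ℝ) => L v) (by simp)
  have hint2 : Integrable (fun y => f y * fderiv ℝ w y v) := by
    refine Continuous.integrable_of_hasCompactSupport ?_ hwvc.mul_left
    exact hfC.continuous.mul ((hwC.continuous_fderiv (by norm_num)).clm_apply continuous_const)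
  have hibp : ∫ y, f y * fderiv ℝ w y v = - ∫ y, fderiv ℝ f y v * w y := by
    refine integral_mul_fderiv_eq_neg_fderiv_mul_of_integrable hint1 hint2 ?_
      (fun y _ => hfC.differentiable (by norm_num) y) (fun y _ => hwC.differentiable (by norm_num) y)
    exact Continuous.integrable_of_hasCompactSupport (hfC.continuous.mul hwC.continuous) hwc.mul_left
  -- upper bound
  have hcontDζ : Continuous (fun y => ‖fderiv ℝ ζ y‖) := (hζ.continuous_fderiv (by norm_num)).norm
  have hloc : ∀ (g : EuclideanSpace ℝ (Fin n) → ℝ) (ρ : ℝ), Continuous g → IntegrableOn g (ball x ρ) := fun g ρ hg =>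
    (hg.continuousOn.integrableOn_compact (isCompact_closedBall x ρ)).mono_set ball_subset_closedBall
  set B := volume.real (ball x r) with hB
  have hB0 : 0 < B := by
    rw [hB, measureReal_def]
    exact ENNReal.toReal_pos (measure_ball_pos _ _ hr0).ne' measure_ball_lt_top.ne
  have hB3 : volume.real (ball x (3 * r)) = 3 ^ n * B := by
    rw [hB, gn_vol x hr0, gn_vol x (by positivity)]; ring
  have hup : |∫ y, f y * fderiv ℝ w y v| ≤ 2 * K * ((A + D / r) * (3 ^ n * B)) := by
    calc |∫ y, f y * fderiv ℝ w y v| ≤ ∫ y, (ball x (3 * r)).indicator (fun y => 2 * K * (‖fderiv ℝ ζ y‖ + D / r)) y := by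
          rw [← Real.norm_eq_abs]
          refine norm_integral_le_of_norm_le ?_ ?_
          · rw [integrable_indicator_iff measurableSet_ball]
            exact hloc _ _ (by fun_prop)
          · refine Filter.Eventually.of_forall fun y => ?_
            rw [norm_mul]
            have h1 : ‖f y‖ ≤ 2 * K := by
              rw [hf]; simp only [norm_mul, Real.norm_of_nonneg hK0.le, Real.norm_eq_abs]
              have : |Real.arctan (V y / K)| ≤ 2 := by
                rw [abs_le]
                constructor
                · linarith [Real.neg_pi_div_two_lt_arctan (V y / K), Real.pi_lt_four]
                · linarith [Real.arctan_lt_pi_div_two (V y / K), Real.pi_lt_four]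
              nlinarith
            have h2 : ‖fderiv ℝ w y v‖ ≤ ‖fderiv ℝ w y‖ := by
              calc _ ≤ ‖fderiv ℝ w y‖ * ‖v‖ := ContinuousLinearMap.le_opNorm _ _
                _ ≤ ‖fderiv ℝ w y‖ * 1 := by gcongr
                _ = _ := mul_one _
            have h3 := h2.trans (hDw y)
            have h4 : (ball x (3 * r)).indicator (fun y => 2 * K * (‖fderiv ℝ ζ y‖ + D / r)) y
                = 2 * K * (ball x (3 * r)).indicator (fun y => (‖fderiv ℝ ζ y‖ + D / r)) y := by
              by_cases hy : y ∈ ball x (3 * r)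
              · rw [Set.indicator_of_mem hy, Set.indicator_of_mem hy]
              · rw [Set.indicator_of_notMem hy, Set.indicator_of_notMem hy, mul_zero]
            rw [h4]
            exact mul_le_mul h1 h3 (norm_nonneg _) (by positivity)
      _ = 2 * K * ((∫ y in ball x (3 * r), ‖fderiv ℝ ζ y‖) + D / r * (3 ^ n * B)) := by
          rw [integral_indicator measurableSet_ball, integral_const_mul, integral_add (hloc _ _ hcontDζ)
            (hloc _ _ continuous_const), setIntegral_const, hB3, smul_eq_mul]
          ring
      _ ≤ 2 * K * (A * (3 ^ n * B) + D / r * (3 ^ n * B)) := by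
          have := hN (3 * r) (by positivity)
          rw [hB3] at this
          gcongr
      _ = _ := by ring
  -- lower bound
  have hVc := hVC.continuous
  have hζcont := hζ.continuous
  have hlow : σ * (B / 2) ≤ ∫ y, fderiv ℝ f y v * w y := by
    have h1 : ∫ y, (ball x r).indicator (fun y => σ * (ζ y - ζ y * |V y| / K)) y ≤ ∫ y, fderiv ℝ f y v * w y := by
      refine integral_mono ?_ hint1 ?_
      · rw [integrable_indicator_iff measurableSet_ball]
        exact hloc _ _ (by fun_prop)
      · intro y
        simp only
        rw [hfd y]
        have hT : 0 < 1 / (1 + (V y / K) ^ 2) := by positivity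
        by_cases hz : ζ y = 0
        · have : (ball x r).indicator (fun y => σ * (ζ y - ζ y * |V y| / K)) y = 0 := by
            simp [Set.indicator, hz]
          rw [this]; simp [hw, hz]
        have hs := hσs y hz
        by_cases hy : y ∈ ball x r
        · rw [Set.indicator_of_mem hy]
          simp only [hw, hφin y hy, mul_one]
          have ha := gn_arctan_aux (V y / K)
          rw [abs_div, abs_of_pos hK0] at ha
          calc σ * (ζ y - ζ y * |V y| / K) = (1 - |V y| / K) * (σ * ζ y) := by ring
            _ ≤ 1 / (1 + (V y / K) ^ 2) * (σ * ζ y) := by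
              gcongr
              exact mul_nonneg hσ (hζ0 y)
            _ ≤ 1 / (1 + (V y / K) ^ 2) * (ℓ (fderiv ℝ U y v) * ζ y) := by
              gcongr
              exact hζ0 y
            _ = _ := by ring
        · rw [Set.indicator_of_notMem hy]
          exact mul_nonneg (mul_nonneg hT.le (hσ.trans hs)) (mul_nonneg (hζ0 y) (hφ01 y))
    refine le_trans ?_ h1
    rw [integral_indicator measurableSet_ball, integral_const_mul, integral_sub (hloc _ _ hζcont)
      (hloc _ _ (by fun_prop)), integral_div]
    refine mul_le_mul_of_nonneg_left ?_ hσ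
    have h2 := gn_poincare ζ hζ hζc x A hN hr0
    rw [hζx, one_mul, hrA, ← hB] at h2
    have h3 : ∫ y in ball x r, ζ y * |V y| ≤ β * B := by
      have hUc := hU.continuous
      have hint : IntegrableOn (fun y => ‖U y - c‖) (Ω ∩ ball x r) :=
        (hloc _ r (by fun_prop)).mono_set Set.inter_subset_right
      calc ∫ y in ball x r, ζ y * |V y| ≤ ∫ y in ball x r, Ω.indicator (fun y => ‖U y - c‖) y := by
            refine setIntegral_mono (hloc _ _ (by fun_prop)) ?_ ?_
            · exact (hloc _ r (by fun_prop)).indicator hΩ.measurableSet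
            · intro y
              simp only
              by_cases hz : ζ y = 0
              · rw [hz, zero_mul]; exact Set.indicator_nonneg (fun _ _ => norm_nonneg _) _
              · rw [Set.indicator_of_mem (hζΩ y hz)]
                calc ζ y * |V y| ≤ 1 * ‖V y‖ := by gcongr; exact hζ1 y; exact le_rfl
                  _ = ‖V y‖ := one_mul _
                  _ ≤ ‖ℓ‖ * ‖U y - c‖ := ContinuousLinearMap.le_opNorm _ _
                  _ ≤ 1 * ‖U y - c‖ := by gcongr
                  _ = _ := one_mul _
        _ = ∫ y in Ω ∩ ball x r, ‖U y - c‖ := by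
            rw [setIntegral_indicator hΩ.measurableSet, Set.inter_comm]
        _ = volume.real (Ω ∩ ball x r) * ⨍ y in Ω ∩ ball x r, ‖U y - c‖ := by
            have hfin : volume (Ω ∩ ball x r) ≠ ⊤ := ((measure_mono Set.inter_subset_right).trans_lt measure_ball_lt_top).ne
            have hpos : 0 < volume (Ω ∩ ball x r) :=
              (hΩ.inter isOpen_ball).measure_pos _ ⟨x, hx, mem_ball_self hr0⟩
            rw [setAverage_eq, smul_eq_mul, mul_inv_cancel_left₀]
            rw [measureReal_def]
            exact (ENNReal.toReal_pos hpos.ne' hfin).ne'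
        _ ≤ B * β := by
            refine mul_le_mul ?_ (hosc r hr0) ?_ hB0.le
            · exact measureReal_mono Set.inter_subset_right measure_ball_lt_top.ne
            · rw [setAverage_eq]
              exact mul_nonneg (by positivity) (integral_nonneg fun _ => norm_nonneg _)
        _ = _ := mul_comm _ _
    have h4 : (∫ y in ball x r, ζ y * |V y|) / K ≤ B / 4 := by
      rw [div_le_iff₀ hK0, hK]; linarith
    linarith
  have h5 : σ * (B / 2) ≤ 2 * K * ((A + D / r) * (3 ^ n * B)) := by
    refine hlow.trans (le_trans ?_ hup)
    rw [hibp, abs_neg]; exact le_abs_self _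
  have h6 : D / r = 4 * D * A := by rw [hr]; field_simp
  rw [h6, hK] at h5
  have h7 : B * σ ≤ B * (16 * 3 ^ n * (1 + 4 * D) * β * A) := by nlinarith
  exact le_of_mul_le_mul_left h7 hB0


lemma gn_smooth : ∃ L > 0, ∀ t, |deriv Real.smoothTransition t| ≤ L := by
  have hC : ContDiff ℝ 1 Real.smoothTransition := Real.smoothTransition.contDiff
  have hc : Continuous (deriv Real.smoothTransition) := hC.continuous_deriv (by norm_num)
  obtain ⟨L, hL⟩ := (isCompact_Icc (a := (0:ℝ)) (b := 1)).exists_bound_of_continuousOn hc.continuousOn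
  refine ⟨max L 1, by positivity, fun t => ?_⟩
  by_cases h0 : t < 0
  · have : Real.smoothTransition =ᶠ[nhds t] fun _ => (0:ℝ) := by
      filter_upwards [Iio_mem_nhds h0] with z hz
      exact Real.smoothTransition.zero_of_nonpos (le_of_lt hz)
    rw [this.deriv_eq]; simp
  by_cases h1 : 1 < t
  · have : Real.smoothTransition =ᶠ[nhds t] fun _ => (1:ℝ) := by
      filter_upwards [Ioi_mem_nhds h1] with z hz
      exact Real.smoothTransition.one_of_one_le (le_of_lt hz)
    rw [this.deriv_eq]; simp
  · exact (hL t ⟨not_lt.1 h0, not_lt.1 h1⟩).trans (le_max_left _ _)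

lemma gn_smooth_zero {t : ℝ} (ht : t < 0) : deriv Real.smoothTransition t = 0 := by
  have : Real.smoothTransition =ᶠ[nhds t] fun _ => (0:ℝ) := by
    filter_upwards [Iio_mem_nhds ht] with z hz
    exact Real.smoothTransition.zero_of_nonpos (le_of_lt hz)
  rw [this.deriv_eq]; simp

/-- elementary Young-type inequality -/
lemma gn_young {a b p : ℝ} (ha : 0 ≤ a) (hb : 0 ≤ b) (hp : 1 ≤ p) :
    a ^ p * b ≤ a ^ (p + 1) + b ^ (p + 1) := by
  rcases le_total a b with h | h
  · calc a ^ p * b ≤ b ^ p * b := by gcongr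
      _ = b ^ (p + 1) := by rw [Real.rpow_add_one' hb (by linarith)]
      _ ≤ _ := by have := Real.rpow_nonneg ha (p+1); linarith
  · calc a ^ p * b ≤ a ^ p * a := by gcongr
      _ = a ^ (p + 1) := by rw [Real.rpow_add_one' ha (by linarith)]
      _ ≤ _ := by have := Real.rpow_nonneg hb (p+1); linarith

set_option maxHeartbeats 4000000 in
lemma gn_pointwise (n : ℕ) (p : ℝ) (hp : 1 ≤ p) : ∃ C > 0, ∀ (m : ℕ)
    (Ω : Set (EuclideanSpace ℝ (Fin n))), IsOpen Ω →
    ∀ (U : EuclideanSpace ℝ (Fin n) → EuclideanSpace ℝ (Fin m)), ContDiff ℝ 2 U →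
    HasCompactSupport U → tsupport U ⊆ Ω →
    ∀ (ψ d H : EuclideanSpace ℝ (Fin n) → ℝ) (k₁ : ℝ), 0 ≤ k₁ →
    (∀ y, 0 < ψ y) → ContDiffOn ℝ 1 ψ Ω → (∀ y, 0 ≤ d y) →
    (∀ y ∈ Ω, ‖fderiv ℝ ψ y‖ ≤ k₁ * ψ y * d y) →
    (∀ y, 0 ≤ H y) → Integrable H →
    (∀ y ∈ Ω, p * ψ y * ‖fderiv ℝ U y‖ ^ (p - 1) * ‖iteratedFDeriv ℝ 2 U y‖
      + k₁ * ψ y * (d y ^ (p + 1) + ‖fderiv ℝ U y‖ ^ (p + 1)) ≤ H y) →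
    ∀ (β : ℝ), 0 < β → ∀ x ∈ Ω,
    (∀ R > 0, ⨍ z in Ω ∩ ball x R, ‖U z - ⨍ y in Ω ∩ ball x R, U y‖ ≤ β) →
    ∀ M : ℝ, 0 ≤ M → (∀ ρ > 0, ∫ y in ball x ρ, H y ≤ M * volume.real (ball x ρ)) →
    ψ x * ‖fderiv ℝ U x‖ ^ (p + 1) ≤ C * β * (M + k₁ * (ψ x * ‖fderiv ℝ U x‖ ^ (p + 1))) := by
  obtain ⟨C₀, hC₀, hloc⟩ := gn_local n
  obtain ⟨L, hL, hLb⟩ := gn_smooth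
  set L' := L * (2 * 2 ^ p + 2) with hL'
  have h2p : 0 < (2:ℝ) ^ p := by positivity
  have hL'0 : 0 < L' := by positivity
  refine ⟨16 * C₀ * L', by positivity, ?_⟩
  intro m Ω hΩ U hU hUc hUΩ ψ d H k₁ hk₁ hψ hψC hd hψd hH0 hHi hHb β hβ x hx hosc M hM hMb
  set τ := ‖fderiv ℝ U x‖ with hτ
  have hτ0 : 0 ≤ τ := norm_nonneg _
  rcases hτ0.eq_or_lt with h0 | hτpos
  · rw [← h0, Real.zero_rpow (by linarith)]
    simp only [mul_zero, add_zero]; positivity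
  obtain ⟨v, hv1, hv2⟩ := (fderiv ℝ U x).exists_lt_apply_of_lt_opNorm (r := τ / 2) (by linarith)
  obtain ⟨ℓ, hℓ1, hℓ2⟩ := exists_dual_vector'' ℝ (fderiv ℝ U x v)
  have hℓ2 : ℓ (fderiv ℝ U x v) = ‖fderiv ℝ U x v‖ := by simpa using hℓ2
  set s : EuclideanSpace ℝ (Fin n) → ℝ := fun y => ℓ (fderiv ℝ U y v) with hs
  have hUd1 : ContDiff ℝ 1 (fderiv ℝ U) := hU.fderiv_right (by norm_num)
  have hsC : ContDiff ℝ 1 s := ℓ.contDiff.comp (hUd1.clm_apply contDiff_const)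
  have hsle : ∀ y, s y ≤ ‖fderiv ℝ U y‖ := by
    intro y
    calc s y ≤ ‖ℓ (fderiv ℝ U y v)‖ := Real.le_norm_self _
      _ ≤ ‖ℓ‖ * ‖fderiv ℝ U y v‖ := ContinuousLinearMap.le_opNorm _ _
      _ ≤ 1 * (‖fderiv ℝ U y‖ * ‖v‖) := by
        gcongr; exact ContinuousLinearMap.le_opNorm _ _
      _ ≤ 1 * (‖fderiv ℝ U y‖ * 1) := by gcongr
      _ = _ := by ring
  have hsd : ∀ y, ‖fderiv ℝ s y‖ ≤ ‖iteratedFDeriv ℝ 2 U y‖ := by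
    intro y
    have h1 : HasFDerivAt (fderiv ℝ U) (fderiv ℝ (fderiv ℝ U) y) y :=
      (hUd1.differentiable (by norm_num) y).hasFDerivAt
    let Λ : (EuclideanSpace ℝ (Fin n) →L[ℝ] EuclideanSpace ℝ (Fin m)) →L[ℝ] ℝ :=
      ℓ.comp (ContinuousLinearMap.apply ℝ (EuclideanSpace ℝ (Fin m)) v)
    have h2 : HasFDerivAt s (Λ.comp (fderiv ℝ (fderiv ℝ U) y)) y :=
      HasFDerivAt.comp (g := Λ) (f := fderiv ℝ U) y Λ.hasFDerivAt h1
    have h3 : ‖iteratedFDeriv ℝ 2 U y‖ = ‖fderiv ℝ (fderiv ℝ U) y‖ := by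
      rw [← norm_iteratedFDeriv_fderiv, norm_iteratedFDeriv_one]
    rw [h2.fderiv, h3]
    refine ContinuousLinearMap.opNorm_le_bound _ (norm_nonneg (fderiv ℝ (fderiv ℝ U) y)) fun z => ?_
    have h4 : (Λ.comp (fderiv ℝ (fderiv ℝ U) y)) z = ℓ (fderiv ℝ (fderiv ℝ U) y z v) := rfl
    rw [h4]
    calc ‖ℓ (fderiv ℝ (fderiv ℝ U) y z v)‖ ≤ ‖ℓ‖ * ‖fderiv ℝ (fderiv ℝ U) y z v‖ := ContinuousLinearMap.le_opNorm _ _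
      _ ≤ 1 * ((‖fderiv ℝ (fderiv ℝ U) y‖ * ‖z‖) * ‖v‖) := by
        gcongr
        exact (ContinuousLinearMap.le_opNorm _ _).trans (by gcongr; exact ContinuousLinearMap.le_opNorm _ _)
      _ ≤ 1 * ((‖fderiv ℝ (fderiv ℝ U) y‖ * ‖z‖) * 1) := by gcongr
      _ = _ := by ring
  have hsx : τ / 2 ≤ s x := by simp only [hs]; rw [hℓ2]; exact hv2.le
  have hsx0 : 0 < s x := by linarith
  set g : EuclideanSpace ℝ (Fin n) → ℝ := fun y => ψ y * (max (s y) 0) ^ p with hg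
  have hgx : g x = ψ x * s x ^ p := by simp only [hg]; rw [max_eq_left hsx0.le]
  have hgx0 : 0 < g x := by rw [hgx]; have := hψ x; positivity
  set Q := ψ x * τ ^ p with hQ
  have hQ0 : 0 < Q := by have := hψ x; positivity
  have hgQ : Q ≤ 2 ^ p * g x := by
    rw [hgx, hQ]
    calc ψ x * τ ^ p ≤ ψ x * (2 * s x) ^ p := by
          have := (hψ x).le
          gcongr; linarith
      _ = _ := by rw [Real.mul_rpow (by norm_num) hsx0.le]; ring
  set ζ : EuclideanSpace ℝ (Fin n) → ℝ := fun y =>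
    Real.smoothTransition (2 * (g y / g x) - 1) * Real.smoothTransition (2 - ψ y / ψ x) with hζ
  have hζ0 : ∀ y, 0 ≤ ζ y := fun y => mul_nonneg (Real.smoothTransition.nonneg _) (Real.smoothTransition.nonneg _)
  have hζ1 : ∀ y, ζ y ≤ 1 := fun y => mul_le_one₀ (Real.smoothTransition.le_one _)
    (Real.smoothTransition.nonneg _) (Real.smoothTransition.le_one _)
  have hζx : ζ x = 1 := by
    simp only [hζ]
    rw [div_self hgx0.ne', div_self (hψ x).ne',
      Real.smoothTransition.one_of_one_le (by norm_num), Real.smoothTransition.one_of_one_le (by norm_num), one_mul]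
  -- support facts
  have hζsm : ∀ y, g y ≤ g x / 2 → ζ y = 0 := by
    intro y hy
    simp only [hζ]
    rw [Real.smoothTransition.zero_of_nonpos, zero_mul]
    have : g y / g x ≤ 1 / 2 := by rw [div_le_iff₀ hgx0]; linarith
    linarith
  have hgs : ∀ y, s y ≤ 0 → g y = 0 := by
    intro y hy
    simp only [hg]
    rw [max_eq_right hy, Real.zero_rpow (by linarith), mul_zero]
  have hζs : ∀ y, ζ y ≠ 0 → g x / 2 ≤ g y ∧ ψ y ≤ 2 * ψ x ∧ 0 < s y := by
    intro y hy
    refine ⟨?_, ?_, ?_⟩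
    · by_contra h; exact hy (hζsm y (not_le.1 h).le)
    · by_contra h
      apply hy
      simp only [hζ]
      rw [Real.smoothTransition.zero_of_nonpos (x := 2 - ψ y / ψ x), mul_zero]
      have : 2 ≤ ψ y / ψ x := by rw [le_div_iff₀ (hψ x)]; linarith
      linarith
    · by_contra h
      exact hy (hζsm y (by rw [hgs y (not_lt.1 h)]; positivity))
  have hsuppU : ∀ y, 0 < s y → y ∈ tsupport U := by
    intro y hy
    by_contra h
    have : fderiv ℝ U y = 0 := by
      by_contra h'
      exact h (support_fderiv_subset ℝ h')
    simp only [hs, this] at hy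
    simp at hy
  have hcase : ∀ y, (y ∈ Ω ∧ 0 < s y) ∨ ζ =ᶠ[nhds y] fun _ => 0 := by
    intro y
    by_cases hy : y ∈ Ω
    · by_cases hsy : 0 < s y
      · exact Or.inl ⟨hy, hsy⟩
      · right
        have hgc : ContinuousAt g y := by
          refine ((hψC.continuousOn.continuousAt (hΩ.mem_nhds hy))).mul ?_
          refine ContinuousAt.rpow_const ?_ (Or.inr (by linarith))
          exact (hsC.continuous.max continuous_const).continuousAt
        have : g y < g x / 2 := by rw [hgs y (not_lt.1 hsy)]; positivity
        filter_upwards [hgc.eventually_lt_const this] with z hz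
        exact hζsm z hz.le
    · right
      have : y ∉ tsupport U := fun h => hy (hUΩ h)
      filter_upwards [(isClosed_tsupport U).isOpen_compl.mem_nhds this] with z hz
      by_contra h
      exact hz (hsuppU z (hζs z h).2.2)
  have hψA : ∀ y ∈ Ω, ContDiffAt ℝ 1 ψ y := fun y hy => hψC.contDiffAt (hΩ.mem_nhds hy)
  have hgeq : ∀ y, 0 < s y → g =ᶠ[nhds y] fun z => ψ z * s z ^ p := by
    intro y hy
    filter_upwards [hsC.continuous.continuousAt.eventually (lt_mem_nhds hy)] with z hz
    simp only [hg]; rw [max_eq_left (le_of_lt hz)]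
  have hgA : ∀ y ∈ Ω, 0 < s y → ContDiffAt ℝ 1 g y := by
    intro y hy hsy
    refine ContDiffAt.congr_of_eventuallyEq ?_ (hgeq y hsy)
    exact (hψA y hy).mul (hsC.contDiffAt.rpow_const_of_ne hsy.ne')
  have hSC : ContDiff ℝ 1 Real.smoothTransition := Real.smoothTransition.contDiff
  have hζC : ContDiff ℝ 1 ζ := by
    rw [contDiff_iff_contDiffAt]
    intro y
    rcases hcase y with ⟨hy, hsy⟩ | h
    · refine ContDiffAt.mul ?_ ?_
      · exact hSC.contDiffAt.comp y ((contDiffAt_const.mul ((hgA y hy hsy).div_const _)).sub contDiffAt_const)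
      · exact hSC.contDiffAt.comp y (contDiffAt_const.sub ((hψA y hy).div_const _))
    · exact contDiffAt_const.congr_of_eventuallyEq h
  have hζc : HasCompactSupport ζ :=
    HasCompactSupport.of_support_subset_isCompact hUc (fun y hy => hsuppU y (hζs y hy).2.2)
  -- derivative bound
  have hDζ : ∀ y, ‖fderiv ℝ ζ y‖ ≤ L' / Q * (H y + k₁ * (ψ x * τ ^ (p + 1))) := by
    intro y
    have hrhs : 0 ≤ L' / Q * (H y + k₁ * (ψ x * τ ^ (p + 1))) := by
      have := hH0 y; have := hψ x; positivity
    rcases hcase y with ⟨hy, hsy⟩ | h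
    swap
    · rw [h.fderiv_eq]; simpa using hrhs
    have hψy := hψ y
    have hψx := hψ x
    have hψD : HasFDerivAt ψ (fderiv ℝ ψ y) y := ((hψA y hy).differentiableAt (by norm_num)).hasFDerivAt
    have hsD : HasFDerivAt s (fderiv ℝ s y) y := (hsC.differentiable (by norm_num) y).hasFDerivAt
    have hgD : HasFDerivAt g (ψ y • ((p * s y ^ (p - 1)) • fderiv ℝ s y) + (s y ^ p) • fderiv ℝ ψ y) y := by
      refine HasFDerivAt.congr_of_eventuallyEq ?_ (hgeq y hsy)
      exact hψD.mul (hsD.rpow_const (Or.inl hsy.ne'))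
    have hay : 0 ≤ ‖fderiv ℝ U y‖ := norm_nonneg _
    have hgDn : ‖ψ y • ((p * s y ^ (p - 1)) • fderiv ℝ s y) + (s y ^ p) • fderiv ℝ ψ y‖ ≤ H y := by
      refine le_trans ?_ (hHb y hy)
      refine (norm_add_le _ _).trans ?_
      rw [norm_smul, norm_smul, norm_smul, Real.norm_of_nonneg hψy.le,
        Real.norm_of_nonneg (by positivity), Real.norm_of_nonneg (by positivity)]
      have e1 : s y ^ (p - 1) ≤ ‖fderiv ℝ U y‖ ^ (p - 1) :=
        Real.rpow_le_rpow hsy.le (hsle y) (by linarith)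
      have e2 : s y ^ p ≤ ‖fderiv ℝ U y‖ ^ p := Real.rpow_le_rpow hsy.le (hsle y) (by linarith)
      refine add_le_add ?_ ?_
      · calc ψ y * (p * s y ^ (p - 1) * ‖fderiv ℝ s y‖)
            ≤ ψ y * (p * ‖fderiv ℝ U y‖ ^ (p - 1) * ‖iteratedFDeriv ℝ 2 U y‖) := by
              gcongr; exact hsd y
          _ = _ := by ring
      · calc s y ^ p * ‖fderiv ℝ ψ y‖ ≤ ‖fderiv ℝ U y‖ ^ p * (k₁ * ψ y * d y) := by
              gcongr; exact hψd y hy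
          _ = k₁ * ψ y * (‖fderiv ℝ U y‖ ^ p * d y) := by ring
          _ ≤ k₁ * ψ y * (‖fderiv ℝ U y‖ ^ (p+1) + d y ^ (p+1)) := by
              gcongr; exact gn_young hay (hd y) hp
          _ = _ := by ring
    have hS : ∀ t, HasDerivAt Real.smoothTransition (deriv Real.smoothTransition t) t := fun t =>
      (hSC.differentiable (by norm_num) t).hasDerivAt
    have h1 : HasFDerivAt (fun z => Real.smoothTransition (2 * (g z / g x) - 1))
        (deriv Real.smoothTransition (2 * (g y / g x) - 1) • ((2 * (g x)⁻¹) • (ψ y • ((p * s y ^ (p - 1)) • fderiv ℝ s y) + (s y ^ p) • fderiv ℝ ψ y))) y := by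
      refine (hS _).comp_hasFDerivAt y ?_
      have := (hgD.const_mul (2 * (g x)⁻¹)).sub_const 1
      refine this.congr_of_eventuallyEq (Filter.Eventually.of_forall fun z => ?_)
      simp only; ring
    have h2 : HasFDerivAt (fun z => Real.smoothTransition (2 - ψ z / ψ x))
        (deriv Real.smoothTransition (2 - ψ y / ψ x) • ((-(ψ x)⁻¹) • fderiv ℝ ψ y)) y := by
      refine (hS _).comp_hasFDerivAt y ?_
      have := (hψD.const_mul (-(ψ x)⁻¹)).const_add 2
      refine this.congr_of_eventuallyEq (Filter.Eventually.of_forall fun z => ?_)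
      simp only; ring
    have h3 : HasFDerivAt ζ _ y := h1.mul h2
    rw [h3.fderiv]
    -- bounds of the two pieces
    have b1 : ‖deriv Real.smoothTransition (2 * (g y / g x) - 1) • ((2 * (g x)⁻¹) • (ψ y • ((p * s y ^ (p - 1)) • fderiv ℝ s y) + (s y ^ p) • fderiv ℝ ψ y))‖
        ≤ L * (2 * 2 ^ p) / Q * H y := by
      rw [norm_smul, norm_smul, Real.norm_eq_abs, Real.norm_of_nonneg (by positivity)]
      have : (g x)⁻¹ ≤ 2 ^ p / Q := by
        rw [inv_le_comm₀ hgx0 (by positivity), inv_div, div_le_iff₀ h2p]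
        linarith
      calc _ ≤ L * ((2 * (2 ^ p / Q)) * H y) := by
            gcongr
            · exact hLb _
        _ = _ := by ring
    have b2 : ‖deriv Real.smoothTransition (2 - ψ y / ψ x) • ((-(ψ x)⁻¹) • fderiv ℝ ψ y)‖
        ≤ L * 2 / Q * (H y + k₁ * (ψ x * τ ^ (p + 1))) := by
      by_cases hψ2 : 2 - ψ y / ψ x < 0
      · rw [gn_smooth_zero hψ2, zero_smul, norm_zero]
        have := hH0 y; positivity
      rw [norm_smul, norm_smul, norm_neg, norm_inv, Real.norm_eq_abs, Real.norm_of_nonneg hψx.le]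
      have hle : ψ y ≤ 2 * ψ x := by
        have : ψ y / ψ x ≤ 2 := by linarith
        rwa [div_le_iff₀ hψx] at this
      have hτp : 0 < τ ^ p := by positivity
      have hyo : τ ^ p * d y ≤ τ ^ (p + 1) + d y ^ (p + 1) := gn_young hτ0 (hd y) hp
      have hdp : 0 ≤ d y ^ (p + 1) := Real.rpow_nonneg (hd y) _
      have hHy : k₁ * ψ y * d y ^ (p + 1) ≤ H y := by
        refine le_trans ?_ (hHb y hy)
        have e1 : 0 ≤ p * ψ y * ‖fderiv ℝ U y‖ ^ (p - 1) * ‖iteratedFDeriv ℝ 2 U y‖ := by positivity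
        have e2 : 0 ≤ k₁ * ψ y * ‖fderiv ℝ U y‖ ^ (p + 1) := by positivity
        linarith
      have hkey : τ ^ p * (k₁ * ψ y * d y) ≤ 2 * (H y + k₁ * (ψ x * τ ^ (p + 1))) := by
        calc τ ^ p * (k₁ * ψ y * d y) = k₁ * ψ y * (τ ^ p * d y) := by ring
          _ ≤ k₁ * ψ y * (τ ^ (p + 1) + d y ^ (p + 1)) := by gcongr
          _ = k₁ * ψ y * τ ^ (p + 1) + k₁ * ψ y * d y ^ (p + 1) := by ring
          _ ≤ k₁ * (2 * ψ x) * τ ^ (p + 1) + H y := by gcongr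
          _ ≤ _ := by linarith [hH0 y]
      calc _ ≤ L * ((ψ x)⁻¹ * (k₁ * ψ y * d y)) := by
            gcongr
            · exact hLb _
            · exact hψd y hy
        _ = L / Q * (τ ^ p * (k₁ * ψ y * d y)) := by rw [hQ]; field_simp
        _ ≤ L / Q * (2 * (H y + k₁ * (ψ x * τ ^ (p + 1)))) := by gcongr
        _ = _ := by ring
    refine (norm_add_le _ _).trans ?_
    have hsm : ∀ (t : ℝ) (X : EuclideanSpace ℝ (Fin n) →L[ℝ] ℝ), ‖Real.smoothTransition t • X‖ ≤ ‖X‖ := by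
      intro t X
      rw [norm_smul, Real.norm_of_nonneg (Real.smoothTransition.nonneg _)]
      exact mul_le_of_le_one_left (norm_nonneg X) (Real.smoothTransition.le_one t)
    have c3 : L * (2 * 2 ^ p) / Q * H y ≤ L * (2 * 2 ^ p) / Q * (H y + k₁ * (ψ x * τ ^ (p + 1))) := by
      gcongr; exact le_add_of_nonneg_right (by positivity)
    have c4 : L' / Q * (H y + k₁ * (ψ x * τ ^ (p + 1))) = L * 2 / Q * (H y + k₁ * (ψ x * τ ^ (p + 1)))
        + L * (2 * 2 ^ p) / Q * (H y + k₁ * (ψ x * τ ^ (p + 1))) := by rw [hL']; ring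
    rw [c4]
    exact add_le_add ((hsm _ _).trans b2) ((hsm _ _).trans (b1.trans c3))
  -- lower bound of s on the support
  have hslow : ∀ y, ζ y ≠ 0 → s x / 8 ≤ s y := by
    intro y hy
    obtain ⟨e1, e2, e3⟩ := hζs y hy
    have hgy : g y = ψ y * s y ^ p := by simp only [hg]; rw [max_eq_left e3.le]
    rw [hgy, hgx] at e1
    have hψx := hψ x
    by_contra h
    push Not at h
    have f1 : s y ^ p < (s x / 8) ^ p := Real.rpow_lt_rpow e3.le h (by linarith)
    have f2 : (s x / 8) ^ p ≤ s x ^ p / 8 := by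
      rw [Real.div_rpow hsx0.le (by norm_num)]
      gcongr
      calc (8:ℝ) = 8 ^ (1:ℝ) := by simp
        _ ≤ _ := Real.rpow_le_rpow_of_exponent_le (by norm_num) hp
    have f3 : 0 < s x ^ p := by positivity
    have f4 : 0 ≤ s y ^ p := by positivity
    have f5 : ψ y * s y ^ p ≤ 2 * ψ x * s y ^ p := by gcongr
    have f6 : 2 * ψ x * s y ^ p < 2 * ψ x * (s x ^ p / 8) := by gcongr; linarith
    have : 0 < ψ x * s x ^ p := by positivity
    nlinarith
  -- conclusion
  set T := ψ x * τ ^ (p + 1) with hT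
  have hT0 : 0 ≤ T := by have := hψ x; positivity
  have hTQ : T = Q * τ := by rw [hT, hQ, Real.rpow_add_one' hτ0 (by linarith)]; ring
  refine le_of_forall_pos_le_add fun δ hδ => ?_
  set ε := δ / (16 * C₀ * L' * β) with hε
  have hε0 : 0 < ε := by positivity
  have hfin := hloc m Ω hΩ U (hU.of_le (by norm_num)) β hβ x hx hosc ζ hζC hζc
    (fun y hy => hUΩ (hsuppU y (hζs y hy).2.2)) hζ0 hζ1 hζx (L' / Q * (M + k₁ * T + ε)) (by positivity) ?_
    ℓ v hℓ1 hv1.le (s x / 8) (by positivity) hslow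
  · have g1 : τ / 16 ≤ C₀ * β * (L' / Q * (M + k₁ * T + ε)) := by linarith
    have g2 : Q * τ ≤ 16 * C₀ * L' * β * (M + k₁ * T + ε) := by
      have : Q * (τ / 16) ≤ Q * (C₀ * β * (L' / Q * (M + k₁ * T + ε))) := by gcongr
      have e : Q * (C₀ * β * (L' / Q * (M + k₁ * T + ε))) = C₀ * β * L' * (M + k₁ * T + ε) := by
        field_simp
      rw [e] at this
      linarith
    rw [← hTQ] at g2
    refine g2.trans (le_of_eq ?_)
    rw [hε]; field_simp
  · intro ρ hρ
    have hint : IntegrableOn (fun y => L' / Q * (H y + k₁ * T)) (ball x ρ) :=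
      (hHi.integrableOn.add (integrableOn_const measure_ball_lt_top.ne)).const_mul _
    calc ∫ y in ball x ρ, ‖fderiv ℝ ζ y‖ ≤ ∫ y in ball x ρ, L' / Q * (H y + k₁ * T) := by
          refine setIntegral_mono ?_ hint hDζ
          exact ((hζC.continuous_fderiv (by norm_num)).norm.continuousOn.integrableOn_compact
            (isCompact_closedBall x ρ)).mono_set ball_subset_closedBall
      _ = L' / Q * ((∫ y in ball x ρ, H y) + k₁ * T * volume.real (ball x ρ)) := by
          rw [integral_const_mul, integral_add hHi.integrableOn (integrableOn_const measure_ball_lt_top.ne),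
            setIntegral_const, smul_eq_mul]
          ring
      _ ≤ L' / Q * (M * volume.real (ball x ρ) + k₁ * T * volume.real (ball x ρ) + ε * volume.real (ball x ρ)) := by
          refine mul_le_mul_of_nonneg_left ?_ (by positivity)
          have := hMb ρ hρ
          have : 0 ≤ ε * volume.real (ball x ρ) := by positivity
          linarith
      _ = _ := by ring


lemma gnMax_ball {n : ℕ} (H : EuclideanSpace ℝ (Fin n) → ℝ) (hH0 : ∀ y, 0 ≤ H y)
    (hHi : Integrable H) (x : EuclideanSpace ℝ (Fin n))
    (hx : gnMax (fun y => ENNReal.ofReal (H y)) x ≠ ⊤) (ρ : ℝ) (hρ : 0 < ρ) :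
    ∫ y in ball x ρ, H y ≤ 2 ^ n * (gnMax (fun y => ENNReal.ofReal (H y)) x).toReal * volume.real (ball x ρ) := by
  obtain ⟨k, hk1, hk2⟩ := exists_mem_Ioc_zpow hρ (one_lt_two)
  set r : ℝ := 2 ^ (k + 1) with hr
  have hr0 : 0 < r := by positivity
  have hr2 : r ≤ 2 * ρ := by
    rw [hr, zpow_add_one₀ (by norm_num)]; linarith
  set G := gnMax (fun y => ENNReal.ofReal (H y)) x with hG
  have h1 : (∫⁻ y in closedBall x r, ENNReal.ofReal (H y)) / volume (closedBall x r) ≤ G := by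
    rw [hG]; unfold gnMax
    exact le_iSup (fun k : ℤ => (∫⁻ y in closedBall x ((2:ℝ) ^ k), ENNReal.ofReal (H y)) / volume (closedBall x ((2:ℝ) ^ k))) (k+1)
  have hv0 : volume (closedBall x r) ≠ 0 := (measure_closedBall_pos volume x hr0).ne'
  have hvt : volume (closedBall x r) ≠ ⊤ := measure_closedBall_lt_top.ne
  have h2 : ∫⁻ y in closedBall x r, ENNReal.ofReal (H y) ≤ G * volume (closedBall x r) := by
    rwa [ENNReal.div_le_iff hv0 hvt] at h1
  have h3 : ∫ y in closedBall x r, H y ≤ G.toReal * volume.real (closedBall x r) := by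
    rw [integral_eq_lintegral_of_nonneg_ae (Filter.Eventually.of_forall hH0) hHi.aestronglyMeasurable.restrict]
    rw [measureReal_def, ← ENNReal.toReal_mul]
    exact ENNReal.toReal_mono (ENNReal.mul_ne_top hx hvt) h2
  have h4 : volume.real (closedBall x r) ≤ 2 ^ n * volume.real (ball x ρ) := by
    rw [measureReal_def, Measure.addHaar_closedBall _ _ hr0.le, finrank_euclideanSpace_fin,
      ENNReal.toReal_mul, ENNReal.toReal_ofReal (by positivity), ← measureReal_def, gn_vol x hρ]
    calc r ^ n * _ ≤ (2 * ρ) ^ n * volume.real (ball (0 : EuclideanSpace ℝ (Fin n)) 1) := by gcongr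
      _ = _ := by rw [mul_pow]; ring
  calc ∫ y in ball x ρ, H y ≤ ∫ y in closedBall x r, H y := by
        refine setIntegral_mono_set hHi.integrableOn (Filter.Eventually.of_forall hH0) ?_
        exact Filter.Eventually.of_forall (ball_subset_closedBall.trans (closedBall_subset_closedBall hk2))
    _ ≤ G.toReal * volume.real (closedBall x r) := h3
    _ ≤ G.toReal * (2 ^ n * volume.real (ball x ρ)) := by gcongr
    _ = _ := by ring

lemma gn_finish {n : ℕ} (hn : 2 ≤ n) (Ω : Set (EuclideanSpace ℝ (Fin n)))
    (f H : EuclideanSpace ℝ (Fin n) → ℝ) (A k : ℝ) (hA : 0 ≤ A) (hf0 : ∀ x, 0 ≤ f x)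
    (hfm : AEStronglyMeasurable f (volume.restrict Ω))
    (hf2 : IntegrableOn (fun x => f x ^ 2) Ω) (hHm : Measurable H) (hH0 : ∀ x, 0 ≤ H x)
    (hHi : Integrable H) (hH2 : Integrable (fun x => H x ^ 2))
    (hpt : ∀ᵐ x ∂(volume.restrict Ω),
      f x ≤ A * (2 ^ n * (gnMax (fun y => ENNReal.ofReal (H y)) x).toReal + k * f x)) :
    ∫ x in Ω, f x ^ 2 ≤ A * (2 ^ n * √(8 * 4 ^ n) * √(∫ x in Ω, f x ^ 2) * √(∫ x, H x ^ 2)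
      + k * ∫ x in Ω, f x ^ 2) := by
  set H' : EuclideanSpace ℝ (Fin n) → ENNReal := fun y => ENNReal.ofReal (H y) with hH'
  have hH'm : Measurable H' := hHm.ennreal_ofReal
  have hi : ∫⁻ y, H' y ≠ ⊤ := ((hasFiniteIntegral_iff_ofReal (Filter.Eventually.of_forall hH0)).1 hHi.2).ne
  set G : EuclideanSpace ℝ (Fin n) → ℝ := fun x => (gnMax H' x).toReal with hG
  have hGm : Measurable G := (gnMax_measurable H' hH'm).ennreal_toReal
  have hG0 : ∀ x, 0 ≤ G x := fun x => ENNReal.toReal_nonneg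
  have hL2 := gnMax_L2 hn H' hH'm hi
  have e1 : ∫⁻ y, (H' y) ^ 2 = ENNReal.ofReal (∫ y, H y ^ 2) := by
    rw [ofReal_integral_eq_lintegral_ofReal hH2 (Filter.Eventually.of_forall fun x => sq_nonneg _)]
    refine lintegral_congr fun y => ?_
    rw [hH']; simp only; rw [ENNReal.ofReal_pow (hH0 y)]
  have e2 : ∫⁻ x, ENNReal.ofReal (G x ^ 2) ≤ ENNReal.ofReal (8 * 4 ^ n * ∫ y, H y ^ 2) := by
    calc ∫⁻ x, ENNReal.ofReal (G x ^ 2) ≤ ∫⁻ x, (gnMax H' x) ^ 2 := by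
          refine lintegral_mono fun x => ?_
          simp only
          rw [ENNReal.ofReal_pow (hG0 x)]
          gcongr
          exact ENNReal.ofReal_toReal_le
      _ ≤ _ := hL2
      _ = _ := by
          rw [e1, ENNReal.ofReal_mul (by positivity), ENNReal.ofReal_mul (by positivity),
            ENNReal.ofReal_pow (by positivity)]
          simp
  have hG2 : Integrable (fun x => G x ^ 2) := by
    refine ⟨(hGm.pow_const 2).aestronglyMeasurable, ?_⟩
    rw [hasFiniteIntegral_iff_ofReal (Filter.Eventually.of_forall fun x => sq_nonneg _)]
    exact e2.trans_lt ENNReal.ofReal_lt_top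
  have hH2n : 0 ≤ ∫ y, H y ^ 2 := integral_nonneg fun x => sq_nonneg _
  have e3 : ∫ x, G x ^ 2 ≤ 8 * 4 ^ n * ∫ y, H y ^ 2 := by
    rw [integral_eq_lintegral_of_nonneg_ae (Filter.Eventually.of_forall fun x => sq_nonneg _)
      (hGm.pow_const 2).aestronglyMeasurable]
    exact ENNReal.toReal_le_of_le_ofReal (by positivity) e2
  have e4 : ∫ x in Ω, G x ^ 2 ≤ 8 * 4 ^ n * ∫ y, H y ^ 2 :=
    (setIntegral_le_integral hG2 (Filter.Eventually.of_forall fun x => sq_nonneg _)).trans e3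
  have mf : MemLp f 2 (volume.restrict Ω) := (memLp_two_iff_integrable_sq hfm).2 hf2
  have mG : MemLp G 2 (volume.restrict Ω) :=
    (memLp_two_iff_integrable_sq hGm.aestronglyMeasurable).2 hG2.integrableOn
  have hfG : Integrable (fun x => f x * G x) (volume.restrict Ω) := mf.integrable_mul mG
  have cs : ∫ x in Ω, f x * G x ≤ √(∫ x in Ω, f x ^ 2) * √(∫ x in Ω, G x ^ 2) := by
    have := integral_mul_le_Lp_mul_Lq_of_nonneg (μ := volume.restrict Ω) Real.HolderConjugate.two_two
      (Filter.Eventually.of_forall hf0) (Filter.Eventually.of_forall hG0)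
      (by simpa using mf) (by simpa using mG)
    simpa [Real.sqrt_eq_rpow] using this
  have hint : ∫ x in Ω, f x ^ 2 ≤ ∫ x in Ω, A * (2 ^ n * (f x * G x) + k * f x ^ 2) := by
    refine integral_mono_ae hf2 (((hfG.const_mul _).add (hf2.const_mul _)).const_mul _) ?_
    filter_upwards [hpt] with x hx
    have := mul_le_mul_of_nonneg_left hx (hf0 x)
    calc f x ^ 2 = f x * f x := sq _
      _ ≤ _ := this
      _ = _ := by ring
  rw [integral_const_mul, integral_add (hfG.const_mul _) (hf2.const_mul _), integral_const_mul,
    integral_const_mul] at hint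
  refine hint.trans ?_
  refine mul_le_mul_of_nonneg_left ?_ hA
  have e5 : √(∫ x in Ω, G x ^ 2) ≤ √(8 * 4 ^ n) * √(∫ y, H y ^ 2) := by
    rw [← Real.sqrt_mul (by positivity)]
    exact Real.sqrt_le_sqrt e4
  have e6 : 2 ^ n * ∫ x in Ω, f x * G x ≤ 2 ^ n * (√(∫ x in Ω, f x ^ 2) * (√(8 * 4 ^ n) * √(∫ y, H y ^ 2))) := by
    gcongr
    exact cs.trans (by gcongr)
  linarith


lemma gn_avg_le {n : ℕ} {E : Type*} [NormedAddCommGroup E] [NormedSpace ℝ E]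
    (s : Set (EuclideanSpace ℝ (Fin n))) (hs : volume s < ⊤) (f : EuclideanSpace ℝ (Fin n) → E)
    (B : ℝ) (hB : 0 ≤ B) (hf : ∀ z, ‖f z‖ ≤ B) : ‖⨍ z in s, f z‖ ≤ B := by
  rw [setAverage_eq, norm_smul, norm_inv, Real.norm_of_nonneg measureReal_nonneg]
  have h := norm_setIntegral_le_of_norm_le_const hs (fun z _ => hf z)
  rcases (measureReal_nonneg (μ := volume) (s := s)).eq_or_lt with h0 | h0
  · rw [← h0]; simpa using hB
  · rw [inv_mul_le_iff₀ h0]; linarith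

lemma gn_osc {n m : ℕ} (Ω : Set (EuclideanSpace ℝ (Fin n)))
    (U : EuclideanSpace ℝ (Fin n) → EuclideanSpace ℝ (Fin m)) (hU : Continuous U)
    (hUc : HasCompactSupport U) : BddAbove (oscSet Ω U) := by
  obtain ⟨B, hB⟩ := hUc.exists_bound_of_continuous hU
  have hB0 : 0 ≤ B := (norm_nonneg _).trans (hB 0)
  refine ⟨2 * B, ?_⟩
  rintro a ⟨x₀, -, R, -, rfl⟩
  have hs : volume (Ω ∩ ball x₀ R) < ⊤ := (measure_mono Set.inter_subset_right).trans_lt measure_ball_lt_top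
  refine (Real.le_norm_self _).trans (gn_avg_le _ hs _ (2 * B) (by positivity) fun z => ?_)
  rw [norm_norm]
  refine (norm_sub_le _ _).trans ?_
  have := gn_avg_le _ hs U B hB0 hB
  linarith [hB z]

lemma gn_bmo_nonneg {n m : ℕ} (Ω : Set (EuclideanSpace ℝ (Fin n)))
    (U : EuclideanSpace ℝ (Fin n) → EuclideanSpace ℝ (Fin m)) : 0 ≤ bmoSeminorm Ω U := by
  refine Real.sSup_nonneg ?_
  rintro a ⟨x₀, -, R, -, rfl⟩
  exact integral_nonneg fun z => norm_nonneg _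

lemma gn_rpow_sq {a q : ℝ} (ha : 0 ≤ a) (r : ℝ) (h : r = 2 * q) : (a ^ q) ^ 2 = a ^ r := by
  rw [h, mul_comm, Real.rpow_mul ha]; norm_num

lemma gn_arith {p N k₁ k₂ I₁ Ih I₂ V : ℝ} (hp : 1 ≤ p) (hN0 : 0 ≤ N) (hk₁ : 0 ≤ k₁) (hk₂ : 0 ≤ k₂)
    (n₁ : 0 ≤ I₁) (nh : 0 ≤ Ih) (n₂ : 0 ≤ I₂)
    (vH2 : V ≤ 3 * ((p * k₂) ^ 2 * I₂ + k₁ ^ 2 * Ih + k₁ ^ 2 * I₁)) :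
    N * (√I₁ * √V) + k₁ * I₁ ≤ (2 * N * (p + 2) + 1) * (k₁ * (I₁ + Ih) + k₂ * √I₁ * √I₂) := by
  set X := k₁ * (I₁ + Ih) + k₂ * √I₁ * √I₂ with hX
  set R := √I₁ * √V with hR
  have s1 := Real.sq_sqrt n₁
  have sh := Real.sq_sqrt nh
  have s2 := Real.sq_sqrt n₂
  have p1 := Real.sqrt_nonneg I₁
  have ph := Real.sqrt_nonneg Ih
  have p2 := Real.sqrt_nonneg I₂
  have b1 : √(V) ≤ 2 * (p * k₂ * √I₂ + k₁ * √Ih + k₁ * √I₁) := by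
    refine Real.sqrt_le_iff.2 ⟨by positivity, vH2.trans ?_⟩
    have z1 : 0 ≤ (p * k₂ * √I₂) * (k₁ * √Ih) := by positivity
    have z2 : 0 ≤ (p * k₂ * √I₂) * (k₁ * √I₁) := by positivity
    have z3 : 0 ≤ (k₁ * √Ih) * (k₁ * √I₁) := by positivity
    have y1 : (p * k₂) ^ 2 * I₂ = (p * k₂ * √I₂) ^ 2 := by rw [mul_pow _ (√I₂), s2]
    have y2 : k₁ ^ 2 * Ih = (k₁ * √Ih) ^ 2 := by rw [mul_pow _ (√Ih), sh]
    have y3 : k₁ ^ 2 * I₁ = (k₁ * √I₁) ^ 2 := by rw [mul_pow _ (√I₁), s1]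
    rw [y1, y2, y3]
    nlinarith [sq_nonneg (p * k₂ * √I₂), sq_nonneg (k₁ * √Ih), sq_nonneg (k₁ * √I₁)]
  have b2 : R ≤ 2 * (p + 2) * X := by
    have w1 : √I₁ * √Ih ≤ I₁ + Ih := by nlinarith [sq_nonneg (√I₁ - √Ih)]
    have w2 : 0 ≤ k₂ * √I₁ * √I₂ := by positivity
    have w3 : 0 ≤ k₁ * (I₁ + Ih) := by positivity
    calc R ≤ √I₁ * (2 * (p * k₂ * √I₂ + k₁ * √Ih + k₁ * √I₁)) := by rw [hR]; gcongr
      _ = 2 * (p * (k₂ * √I₁ * √I₂)) + 2 * (k₁ * (√I₁ * √Ih)) + 2 * (k₁ * (√I₁) ^ 2) := by ring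
      _ ≤ 2 * (p * (k₂ * √I₁ * √I₂)) + 2 * (k₁ * (I₁ + Ih)) + 2 * (k₁ * (I₁ + Ih)) := by
          rw [s1]; gcongr; linarith
      _ ≤ 2 * (p + 2) * X := by
          rw [hX]
          have : 0 ≤ p * (k₁ * (I₁ + Ih)) := by positivity
          nlinarith
  have b3 : k₁ * I₁ ≤ X := by
    rw [hX]
    have : 0 ≤ k₁ * Ih := by positivity
    have : 0 ≤ k₂ * √I₁ * √I₂ := by positivity
    linarith
  have b4 : N * R ≤ N * (2 * (p + 2) * X) := by gcongr
  linarith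

set_option maxHeartbeats 2000000 in
lemma gn_main
    (n m : ℕ) (hn : 2 ≤ n) (hm : 1 ≤ m) (p M : ℝ) (hp : 1 ≤ p) (hM : 0 < M) :
    ∃ C > 0, ∀ (Ω : Set (EuclideanSpace ℝ (Fin n))), IsOpen Ω → Bornology.IsBounded Ω →
      ∀ (Φ₀ Φ : EuclideanSpace ℝ (Fin m) → ℝ) (k₁ k₂ : ℝ),
        (∀ y, 0 < Φ₀ y) → (∀ y, 0 < Φ y) → ContDiff ℝ 1 Φ →
        (∀ y, ‖fderiv ℝ Φ y‖ ≤ k₁ * Φ y) → (∀ y, Φ y ≤ k₂ * Φ₀ y) →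
      ∀ u U : EuclideanSpace ℝ (Fin n) → EuclideanSpace ℝ (Fin m),
        ContDiffOn ℝ 1 u Ω → ContDiffOn ℝ 2 U Ω →
        HasCompactSupport U → tsupport U ⊆ Ω →
        (∀ a ∈ apSet Ω (p / (p + 2) + 1) fun x => Φ (u x) ^ ((2 : ℝ) / (p + 2)), a ≤ M) →
      ∀ I₁ Ih I₂ : ℝ,
        I₁ = (∫ x in Ω, Φ (u x) ^ 2 * ‖fderiv ℝ U x‖ ^ (2 * p + 2)) →
        Ih = (∫ x in Ω, Φ (u x) ^ 2 * ‖fderiv ℝ u x‖ ^ (2 * p + 2)) →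
        I₂ = (∫ x in Ω,
              Φ₀ (u x) ^ 2 * ‖fderiv ℝ U x‖ ^ (2 * p - 2) * ‖iteratedFDeriv ℝ 2 U x‖ ^ 2) →
        IntegrableOn (fun x => Φ (u x) ^ 2 * ‖fderiv ℝ U x‖ ^ (2 * p + 2)) Ω →
        IntegrableOn (fun x => Φ (u x) ^ 2 * ‖fderiv ℝ u x‖ ^ (2 * p + 2)) Ω →
        IntegrableOn (fun x =>
          Φ₀ (u x) ^ 2 * ‖fderiv ℝ U x‖ ^ (2 * p - 2) * ‖iteratedFDeriv ℝ 2 U x‖ ^ 2) Ω →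
        I₁ ≤ C * bmoNorm Ω U * (k₁ * (I₁ + Ih) + k₂ * Real.sqrt I₁ * Real.sqrt I₂) := by
  obtain ⟨C₀, hC₀, hpw⟩ := gn_pointwise n p hp
  set N : ℝ := 2 ^ n * √(8 * 4 ^ n) with hN
  have hN0 : 0 ≤ N := by positivity
  refine ⟨C₀ * (2 * N * (p + 2) + 1), by positivity, ?_⟩
  intro Ω hΩ hΩb Φ₀ Φ k₁ k₂ hΦ₀ hΦ hΦC hΦd hΦk u U huC hUC hUc hUΩ _ I₁ Ih I₂ hI₁ hIh hI₂ i₁ ih i₂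
  have hU : ContDiff ℝ 2 U := by
    rw [contDiff_iff_contDiffAt]
    intro y
    by_cases hy : y ∈ Ω
    · exact hUC.contDiffAt (hΩ.mem_nhds hy)
    · have hy' : y ∉ tsupport U := fun h => hy (hUΩ h)
      refine contDiffAt_const (c := 0) |>.congr_of_eventuallyEq ?_
      filter_upwards [(isClosed_tsupport U).isOpen_compl.mem_nhds hy'] with z hz
      exact image_eq_zero_of_notMem_tsupport hz
  have hk₁ : 0 ≤ k₁ := by
    have h1 := (norm_nonneg _).trans (hΦd 0)
    exact nonneg_of_mul_nonneg_left h1 (hΦ 0)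
  have hk₂ : 0 ≤ k₂ := by
    have h1 := (hΦ 0).le.trans (hΦk 0)
    exact nonneg_of_mul_nonneg_left h1 (hΦ₀ 0)
  set ψ : EuclideanSpace ℝ (Fin n) → ℝ := fun y => Φ (u y) with hψdef
  have hψ : ∀ y, 0 < ψ y := fun y => hΦ _
  have hψC : ContDiffOn ℝ 1 ψ Ω := hΦC.comp_contDiffOn huC
  set d : EuclideanSpace ℝ (Fin n) → ℝ := fun y => ‖fderiv ℝ u y‖ with hd
  have hd0 : ∀ y, 0 ≤ d y := fun y => norm_nonneg _
  set a : EuclideanSpace ℝ (Fin n) → ℝ := fun y => ‖fderiv ℝ U y‖ with ha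
  have ha0 : ∀ y, 0 ≤ a y := fun y => norm_nonneg _
  set D : EuclideanSpace ℝ (Fin n) → ℝ := fun y => ‖iteratedFDeriv ℝ 2 U y‖ with hD
  have hD0 : ∀ y, 0 ≤ D y := fun y => norm_nonneg _
  have hψd : ∀ y ∈ Ω, ‖fderiv ℝ ψ y‖ ≤ k₁ * ψ y * d y := by
    intro y hy
    have h1 : HasFDerivAt u (fderiv ℝ u y) y :=
      ((huC.contDiffAt (hΩ.mem_nhds hy)).differentiableAt (by norm_num)).hasFDerivAt
    have h2 : HasFDerivAt Φ (fderiv ℝ Φ (u y)) (u y) := (hΦC.differentiable (by norm_num) _).hasFDerivAt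
    have h3 : HasFDerivAt ψ ((fderiv ℝ Φ (u y)).comp (fderiv ℝ u y)) y := h2.comp y h1
    rw [h3.fderiv]
    refine (ContinuousLinearMap.opNorm_comp_le _ _).trans ?_
    exact mul_le_mul_of_nonneg_right (hΦd _) (hd0 y)
  -- the function H
  set h : EuclideanSpace ℝ (Fin n) → ℝ := fun y => p * ψ y * a y ^ (p - 1) * D y
    + k₁ * ψ y * (d y ^ (p + 1) + a y ^ (p + 1)) with hh
  have hh0 : ∀ y, 0 ≤ h y := by
    intro y
    have := (hψ y).le; have := hd0 y; have := ha0 y; have := hD0 y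
    simp only [hh]; positivity
  have haC : Continuous a := (hU.continuous_fderiv (by norm_num)).norm
  have hDC : Continuous D := (hU.continuous_iteratedFDeriv (by norm_num)).norm
  have hdC : ContinuousOn d Ω := (huC.continuousOn_fderiv_of_isOpen hΩ (by norm_num)).norm
  have hhC : ContinuousOn h Ω := by
    have hψc := hψC.continuousOn
    refine ((((continuousOn_const.mul hψc).mul ?_)).mul hDC.continuousOn).add
      ((continuousOn_const.mul hψc).mul (ContinuousOn.add ?_ ?_))
    · exact haC.continuousOn.rpow_const fun _ _ => Or.inr (by linarith)
    · exact hdC.rpow_const fun _ _ => Or.inr (by linarith)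
    · exact haC.continuousOn.rpow_const fun _ _ => Or.inr (by linarith)
  set H : EuclideanSpace ℝ (Fin n) → ℝ := Ω.indicator h with hHdef
  have hHm : Measurable H := by
    classical
    rw [hHdef, ← Set.piecewise_eq_indicator]
    exact hhC.measurable_piecewise continuousOn_const hΩ.measurableSet
  have hH0 : ∀ y, 0 ≤ H y := fun y => Set.indicator_nonneg (fun z _ => hh0 z) y
  have hHh : ∀ y ∈ Ω, h y ≤ H y := fun y hy => by rw [hHdef, Set.indicator_of_mem hy]
  -- square bounds
  have q1 : ∀ y, (a y ^ (p + 1)) ^ 2 = a y ^ (2 * p + 2) := fun y => gn_rpow_sq (ha0 y) _ (by ring)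
  have q2 : ∀ y, (d y ^ (p + 1)) ^ 2 = d y ^ (2 * p + 2) := fun y => gn_rpow_sq (hd0 y) _ (by ring)
  have q3 : ∀ y, (a y ^ (p - 1)) ^ 2 = a y ^ (2 * p - 2) := fun y => gn_rpow_sq (ha0 y) _ (by ring)
  set W : EuclideanSpace ℝ (Fin n) → ℝ := fun y =>
    3 * ((p * k₂) ^ 2 * (Φ₀ (u y) ^ 2 * a y ^ (2 * p - 2) * D y ^ 2)
      + k₁ ^ 2 * (ψ y ^ 2 * d y ^ (2 * p + 2)) + k₁ ^ 2 * (ψ y ^ 2 * a y ^ (2 * p + 2))) with hW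
  have hhW : ∀ y, h y ^ 2 ≤ W y := by
    intro y
    have t3 : ∀ r s t : ℝ, (r + s + t) ^ 2 ≤ 3 * (r ^ 2 + s ^ 2 + t ^ 2) := fun r s t => by
      nlinarith [sq_nonneg (r - s), sq_nonneg (s - t), sq_nonneg (r - t)]
    have e0 : h y = p * ψ y * a y ^ (p - 1) * D y + k₁ * ψ y * d y ^ (p + 1)
        + k₁ * ψ y * a y ^ (p + 1) := by simp only [hh]; ring
    rw [e0]
    refine (t3 _ _ _).trans ?_
    simp only [hW]
    rw [← q1, ← q2, ← q3]
    have hψk : ψ y ^ 2 ≤ (k₂ * Φ₀ (u y)) ^ 2 := pow_le_pow_left₀ (hψ y).le (hΦk _) 2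
    have : (p * ψ y * a y ^ (p - 1) * D y) ^ 2
        ≤ (p * k₂) ^ 2 * (Φ₀ (u y) ^ 2 * (a y ^ (p - 1)) ^ 2 * D y ^ 2) := by
      calc (p * ψ y * a y ^ (p - 1) * D y) ^ 2 = ψ y ^ 2 * (p ^ 2 * (a y ^ (p - 1)) ^ 2 * D y ^ 2) := by ring
        _ ≤ (k₂ * Φ₀ (u y)) ^ 2 * (p ^ 2 * (a y ^ (p - 1)) ^ 2 * D y ^ 2) := by gcongr
        _ = _ := by ring
    have e2 : (k₁ * ψ y * d y ^ (p + 1)) ^ 2 = k₁ ^ 2 * (ψ y ^ 2 * (d y ^ (p + 1)) ^ 2) := by ring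
    have e3 : (k₁ * ψ y * a y ^ (p + 1)) ^ 2 = k₁ ^ 2 * (ψ y ^ 2 * (a y ^ (p + 1)) ^ 2) := by ring
    linarith
  have iW : IntegrableOn W Ω := (((i₂.const_mul _).add (ih.const_mul _)).add (i₁.const_mul _)).const_mul _
  have vW : ∫ y in Ω, W y = 3 * ((p * k₂) ^ 2 * I₂ + k₁ ^ 2 * Ih + k₁ ^ 2 * I₁) := by
    simp only [hW]
    have j₂ : Integrable (fun y => (p * k₂) ^ 2 * (Φ₀ (u y) ^ 2 * a y ^ (2 * p - 2) * D y ^ 2))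
      (volume.restrict Ω) := i₂.const_mul _
    have jh : Integrable (fun y => k₁ ^ 2 * (ψ y ^ 2 * d y ^ (2 * p + 2)))
      (volume.restrict Ω) := ih.const_mul _
    have j₁ : Integrable (fun y => k₁ ^ 2 * (ψ y ^ 2 * a y ^ (2 * p + 2)))
      (volume.restrict Ω) := i₁.const_mul _
    have j₃ : Integrable (fun y => (p * k₂) ^ 2 * (Φ₀ (u y) ^ 2 * a y ^ (2 * p - 2) * D y ^ 2)
      + k₁ ^ 2 * (ψ y ^ 2 * d y ^ (2 * p + 2))) (volume.restrict Ω) := j₂.add jh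
    rw [integral_const_mul, integral_add j₃ j₁, integral_add j₂ jh, integral_const_mul,
      integral_const_mul, integral_const_mul, hI₁, hIh, hI₂]
  have hhm : AEStronglyMeasurable h (volume.restrict Ω) := hhC.aestronglyMeasurable hΩ.measurableSet
  have ih2 : IntegrableOn (fun y => h y ^ 2) Ω := by
    refine Integrable.mono' iW (hhm.pow 2) (Filter.Eventually.of_forall fun y => ?_)
    rw [Real.norm_of_nonneg (sq_nonneg _)]; exact hhW y
  have hHsq : (fun y => H y ^ 2) = Ω.indicator (fun y => h y ^ 2) := by
    funext y
    by_cases hy : y ∈ Ω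
    · simp only [hHdef, Set.indicator_of_mem hy]
    · simp only [hHdef, Set.indicator_of_notMem hy]; norm_num
  have hH2 : Integrable (fun y => H y ^ 2) := by
    rw [hHsq, integrable_indicator_iff hΩ.measurableSet]; exact ih2
  have vH2 : ∫ y, H y ^ 2 ≤ 3 * ((p * k₂) ^ 2 * I₂ + k₁ ^ 2 * Ih + k₁ ^ 2 * I₁) := by
    rw [hHsq, integral_indicator hΩ.measurableSet, ← vW]
    exact integral_mono ih2 iW hhW
  have hΩfin : volume Ω < ⊤ := hΩb.measure_lt_top
  have hHi : Integrable H := by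
    rw [hHdef, integrable_indicator_iff hΩ.measurableSet]
    have : IsFiniteMeasure (volume.restrict Ω) := ⟨by simpa using hΩfin⟩
    exact ((memLp_two_iff_integrable_sq hhm).2 ih2).integrable (by norm_num)
  -- nonnegativity
  have n₁ : 0 ≤ I₁ := by
    rw [hI₁]; exact integral_nonneg fun y => mul_nonneg (sq_nonneg _) (Real.rpow_nonneg (ha0 y) _)
  have nh : 0 ≤ Ih := by
    rw [hIh]; exact integral_nonneg fun y => mul_nonneg (sq_nonneg _) (Real.rpow_nonneg (hd0 y) _)
  have n₂ : 0 ≤ I₂ := by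
    rw [hI₂]; exact integral_nonneg fun y => mul_nonneg (mul_nonneg (sq_nonneg _) (Real.rpow_nonneg (ha0 y) _)) (sq_nonneg _)
  -- the function f
  set f : EuclideanSpace ℝ (Fin n) → ℝ := fun y => ψ y * a y ^ (p + 1) with hf
  have hf0 : ∀ y, 0 ≤ f y := fun y => mul_nonneg (hψ y).le (Real.rpow_nonneg (ha0 y) _)
  have hfsq : (fun y => f y ^ 2) = fun y => ψ y ^ 2 * a y ^ (2 * p + 2) := by
    funext y; simp only [hf]; rw [mul_pow, q1]
  have hfm : AEStronglyMeasurable f (volume.restrict Ω) := by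
    refine ContinuousOn.aestronglyMeasurable (hψC.continuousOn.mul ?_) hΩ.measurableSet
    exact haC.continuousOn.rpow_const fun _ _ => Or.inr (by linarith)
  have hf2 : IntegrableOn (fun y => f y ^ 2) Ω := by rw [hfsq]; exact i₁
  have vf2 : ∫ y in Ω, f y ^ 2 = I₁ := by rw [hfsq, hI₁]
  -- main estimate for every admissible constant
  set X := k₁ * (I₁ + Ih) + k₂ * √I₁ * √I₂ with hX
  have hX0 : 0 ≤ X := by positivity
  set R := √I₁ * √(∫ y, H y ^ 2) with hR
  have hRX : N * R + k₁ * I₁ ≤ (2 * N * (p + 2) + 1) * X :=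
    gn_arith hp hN0 hk₁ hk₂ n₁ nh n₂ vH2
  have hmain : ∀ β, bmoSeminorm Ω U < β → I₁ ≤ C₀ * β * ((2 * N * (p + 2) + 1) * X) := by
    intro β hβ
    have hβ0 : 0 < β := (gn_bmo_nonneg Ω U).trans_lt hβ
    have hfin := gn_finish hn Ω f H (C₀ * β) k₁ (by positivity) hf0 hfm hf2 hHm hH0 hHi hH2 ?_
    · rw [vf2] at hfin
      refine hfin.trans (mul_le_mul_of_nonneg_left ?_ (by positivity))
      refine le_trans (le_of_eq ?_) hRX
      rw [hR, hN]; ring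
    · have hne := gnMax_ae_ne_top hn (fun y => ENNReal.ofReal (H y))
        ((hasFiniteIntegral_iff_ofReal (Filter.Eventually.of_forall hH0)).1 hHi.2).ne
      filter_upwards [ae_restrict_of_ae hne, ae_restrict_mem hΩ.measurableSet] with x hx hxΩ
      refine hpw m Ω hΩ U hU hUc hUΩ ψ d H k₁ hk₁ hψ hψC hd0 hψd hH0 hHi hHh β hβ0 x hxΩ ?_ _
        (by positivity) (fun ρ hρ => gnMax_ball H hH0 hHi x hx ρ hρ)
      intro r hr
      refine le_trans ?_ hβ.le
      exact le_csSup (gn_osc Ω U hU.continuous hUc) ⟨x, hxΩ, r, hr, rfl⟩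
  have hlim : I₁ ≤ C₀ * bmoSeminorm Ω U * ((2 * N * (p + 2) + 1) * X) := by
    set Y := (2 * N * (p + 2) + 1) * X with hY
    have hY0 : 0 ≤ Y := by positivity
    have ht : Filter.Tendsto (fun β => C₀ * β * Y) (nhdsWithin (bmoSeminorm Ω U) (Set.Ioi (bmoSeminorm Ω U)))
        (nhds (C₀ * bmoSeminorm Ω U * Y)) := by
      refine Filter.Tendsto.mono_left ?_ nhdsWithin_le_nhds
      exact Continuous.tendsto (by fun_prop) _
    refine ge_of_tendsto ht ?_
    filter_upwards [self_mem_nhdsWithin] with β hβ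
    exact hmain β hβ
  have hbn : bmoSeminorm Ω U ≤ bmoNorm Ω U := by
    unfold bmoNorm
    have : 0 ≤ ∫ x in Ω, ‖U x‖ := integral_nonneg fun x => norm_nonneg _
    linarith
  calc I₁ ≤ C₀ * bmoSeminorm Ω U * ((2 * N * (p + 2) + 1) * X) := hlim
    _ ≤ C₀ * bmoNorm Ω U * ((2 * N * (p + 2) + 1) * X) := by gcongr
    _ = _ := by ring

/-- Global weighted Gagliardo–Nirenberg inequality involving the BMO norm:
`I₁ ≤ C ‖U‖_{BMO(Ω)} [ k₁(I₁ + Î₁) + k₂ I₁^{1/2} I₂^{1/2} ]`. -/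
theorem global_weighted_gagliardo_nirenberg
    (n m : ℕ) (hn : 2 ≤ n) (hm : 1 ≤ m) (p M : ℝ) (hp : 1 ≤ p) (hM : 0 < M) :
    ∃ C > 0, ∀ (Ω : Set (EuclideanSpace ℝ (Fin n))), IsOpen Ω → Bornology.IsBounded Ω →
      ∀ (Φ₀ Φ : EuclideanSpace ℝ (Fin m) → ℝ) (k₁ k₂ : ℝ),
        (∀ y, 0 < Φ₀ y) → (∀ y, 0 < Φ y) → ContDiff ℝ 1 Φ →
        (∀ y, ‖fderiv ℝ Φ y‖ ≤ k₁ * Φ y) → (∀ y, Φ y ≤ k₂ * Φ₀ y) →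
      ∀ u U : EuclideanSpace ℝ (Fin n) → EuclideanSpace ℝ (Fin m),
        ContDiffOn ℝ 1 u Ω → ContDiffOn ℝ 2 U Ω →
        HasCompactSupport U → tsupport U ⊆ Ω →
        (∀ a ∈ apSet Ω (p / (p + 2) + 1) fun x => Φ (u x) ^ ((2 : ℝ) / (p + 2)), a ≤ M) →
      ∀ I₁ Ih I₂ : ℝ,
        I₁ = (∫ x in Ω, Φ (u x) ^ 2 * ‖fderiv ℝ U x‖ ^ (2 * p + 2)) →
        Ih = (∫ x in Ω, Φ (u x) ^ 2 * ‖fderiv ℝ u x‖ ^ (2 * p + 2)) →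
        I₂ = (∫ x in Ω,
              Φ₀ (u x) ^ 2 * ‖fderiv ℝ U x‖ ^ (2 * p - 2) * ‖iteratedFDeriv ℝ 2 U x‖ ^ 2) →
        IntegrableOn (fun x => Φ (u x) ^ 2 * ‖fderiv ℝ U x‖ ^ (2 * p + 2)) Ω →
        IntegrableOn (fun x => Φ (u x) ^ 2 * ‖fderiv ℝ u x‖ ^ (2 * p + 2)) Ω →
        IntegrableOn (fun x =>
          Φ₀ (u x) ^ 2 * ‖fderiv ℝ U x‖ ^ (2 * p - 2) * ‖iteratedFDeriv ℝ 2 U x‖ ^ 2) Ω →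
        I₁ ≤ C * bmoNorm Ω U * (k₁ * (I₁ + Ih) + k₂ * Real.sqrt I₁ * Real.sqrt I₂) := by
  exact gn_main n m hn hm p M hp hM
end

section
/- Gagliardo–Nirenberg inequality with BMO norm (constant-weight case). Fix integers n ≥ 2, m ≥ 1 and a real p ≥ 1. There is a constant C = C(n,m,p) such that for every bounded open set Ω ⊂ ℝⁿ and every u ∈ C²(Ω,ℝ^m) with compact support contained in Ω, ∫_Ω |Du|^{2p+2} dx ≤ C ‖u‖_{BMO(Ω)}² ∫_Ω |Du|^{2p−2} |D²u|² dx. -/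
open MeasureTheory Metric

open scoped ENNReal

namespace GNBMO

theorem weak_type {E : Type*} [NormedAddCommGroup E] [NormedSpace ℝ E] [MeasurableSpace E]
    [BorelSpace E] [FiniteDimensional ℝ E] [Nontrivial E] (μ : Measure E) [μ.IsAddHaarMeasure]
    (g : E → ℝ) (hgi : Integrable g μ) (hg0 : ∀ x, 0 ≤ g x) (l : ℝ) (hl : 0 < l) (s : Set E)
    (hs : ∀ x ∈ s, ∃ r > 0, l * μ.real (ball x r) < ∫ y in ball x r, g y ∂μ) :
    ENNReal.ofReal (l / 2) * μ s ≤
      4 ^ (Module.finrank ℝ E) * ∫⁻ x, ENNReal.ofReal (g x - l / 2) ∂μ := by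
  set d := Module.finrank ℝ E with hd
  have hdpos : 0 < d := Module.finrank_pos
  have key : ∀ x ∈ s, ∃ r > 0, ENNReal.ofReal (l / 2) * μ (closedBall x r) ≤
      ∫⁻ y in closedBall x r, ENNReal.ofReal (g y - l / 2) ∂μ ∧
      l * μ.real (ball x r) < ∫ y in ball x r, g y ∂μ := by
    intro x hx
    obtain ⟨r, hr, h⟩ := hs x hx
    refine ⟨r, hr, ?_, h⟩
    have h1 : l / 2 * μ.real (ball x r) ≤ ∫ y in ball x r, (g y - l / 2) ∂μ := by
      rw [integral_sub hgi.integrableOn (by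
        exact integrableOn_const measure_ball_lt_top.ne)]
      simp only [integral_const, smul_eq_mul, measureReal_restrict_apply_univ]
      nlinarith
    have hi : Integrable (fun y => g y - l / 2) (μ.restrict (ball x r)) :=
      hgi.integrableOn.sub (integrableOn_const measure_ball_lt_top.ne)
    calc ENNReal.ofReal (l / 2) * μ (closedBall x r)
        = ENNReal.ofReal (l / 2 * μ.real (ball x r)) := by
          rw [ENNReal.ofReal_mul (by positivity), Measure.real,
            ENNReal.ofReal_toReal measure_ball_lt_top.ne, Measure.addHaar_closedBall_eq_addHaar_ball]
      _ ≤ ENNReal.ofReal (∫ y in ball x r, (g y - l / 2) ∂μ) := ENNReal.ofReal_le_ofReal h1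
      _ ≤ ∫⁻ y in ball x r, ENNReal.ofReal (g y - l / 2) ∂μ := by
          rw [integral_eq_lintegral_pos_part_sub_lintegral_neg_part hi]
          refine (ENNReal.ofReal_le_ofReal (sub_le_self _ ENNReal.toReal_nonneg)).trans ?_
          exact ENNReal.ofReal_toReal_le
      _ ≤ _ := lintegral_mono_set ball_subset_closedBall
  choose! r hr hr1 hr2 using key
  have hb : 0 < μ.real (ball (0:E) 1) :=
    ENNReal.toReal_pos (measure_ball_pos _ _ one_pos).ne' measure_ball_lt_top.ne
  have hbound : ∀ x ∈ s, r x ≤ max 1 ((∫ y, g y ∂μ) / (l * μ.real (ball (0:E) 1))) := by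
    intro x hx
    rcases le_total (r x) 1 with h1 | h1
    · exact h1.trans (le_max_left _ _)
    refine le_trans ?_ (le_max_right _ _)
    rw [le_div_iff₀ (by positivity)]
    have h2 : ∫ y in ball x (r x), g y ∂μ ≤ ∫ y, g y ∂μ :=
      setIntegral_le_integral hgi (Filter.Eventually.of_forall hg0)
    have h3 : μ.real (ball x (r x)) = r x ^ d * μ.real (ball (0:E) 1) := by
      rw [Measure.real, Measure.addHaar_ball _ _ (hr x hx).le, ENNReal.toReal_mul,
        ENNReal.toReal_ofReal (pow_nonneg (hr x hx).le _), Measure.real]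
    have h4 : r x ≤ r x ^ d := le_self_pow₀ h1 hdpos.ne'
    have h5 := hr2 x hx
    rw [h3] at h5
    calc r x * (l * μ.real (ball (0:E) 1)) ≤ r x ^ d * (l * μ.real (ball (0:E) 1)) := by gcongr
      _ ≤ _ := by linarith
  obtain ⟨u, hus, hdisj, hcov⟩ := Vitali.exists_disjoint_subfamily_covering_enlargement_closedBall
    s (fun x => x) r _ hbound 4 (by norm_num)
  have hcount : u.Countable := by
    refine hdisj.countable_of_nonempty_interior fun x hx => ?_
    exact ⟨x, ball_subset_interior_closedBall (mem_ball_self (hr x (hus hx)))⟩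
  have hsub : s ⊆ ⋃ b ∈ u, closedBall b (4 * r b) := by
    intro x hx
    obtain ⟨b, hb, h⟩ := hcov x hx
    exact Set.mem_biUnion hb (h (mem_closedBall_self (hr x hx).le))
  have := hcount.to_subtype
  calc ENNReal.ofReal (l / 2) * μ s
      ≤ ENNReal.ofReal (l / 2) * ∑' b : u, μ (closedBall (b : E) (4 * r b)) := by
        gcongr
        exact (measure_mono hsub).trans (measure_biUnion_le μ hcount _)
    _ = 4 ^ d * ∑' b : u, ENNReal.ofReal (l / 2) * μ (closedBall (b : E) (r b)) := by
        rw [← ENNReal.tsum_mul_left, ← ENNReal.tsum_mul_left]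
        congr 1
        ext b
        rw [Measure.addHaar_closedBall_mul μ _ (by norm_num : (0:ℝ) ≤ 4) (hr b (hus b.2)).le,
          ENNReal.ofReal_pow (by norm_num), Measure.addHaar_closedBall_center μ (b : E)]
        simp only [ENNReal.ofReal_ofNat, ← hd]
        ring
    _ ≤ 4 ^ d * ∑' b : u, ∫⁻ y in closedBall (b:E) (r b), ENNReal.ofReal (g y - l / 2) ∂μ := by
        gcongr with b
        exact hr1 b (hus b.2)
    _ = 4 ^ d * ∫⁻ y in ⋃ b ∈ u, closedBall (b:E) (r b), ENNReal.ofReal (g y - l / 2) ∂μ := by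
        rw [lintegral_biUnion hcount (fun b _ => measurableSet_closedBall) hdisj]
    _ ≤ _ := by
        gcongr
        exact Measure.restrict_le_self

theorem strong_type {E : Type*} [NormedAddCommGroup E] [NormedSpace ℝ E] [MeasurableSpace E]
    [BorelSpace E] [FiniteDimensional ℝ E] [Nontrivial E] (μ : Measure E) [μ.IsAddHaarMeasure]
    (f g : E → ℝ) (hfc : Measurable f) (hf0 : ∀ x, 0 ≤ f x)
    (hgc : Measurable g) (hgi : Integrable g μ) (hg0 : ∀ x, 0 ≤ g x)
    (K : ℝ) (hK : 0 < K)
    (h : ∀ x, ∀ l > 0, (∀ r > 0, ∫ y in ball x r, g y ∂μ ≤ l * μ.real (ball x r)) → f x ≤ K * l) :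
    ∫⁻ x, ENNReal.ofReal (f x ^ 2) ∂μ ≤ 
      ENNReal.ofReal (8 * 4 ^ (Module.finrank ℝ E) * K ^ 2) * ∫⁻ x, ENNReal.ofReal (g x ^ 2) ∂μ := by
  have hlc := lintegral_rpow_eq_lintegral_meas_lt_mul μ (f := f) (Filter.Eventually.of_forall hf0)
    hfc.aemeasurable (p := 2) (by norm_num)
  norm_num at hlc
  rw [hlc]
  set d := Module.finrank ℝ E with hd
  have step : ∀ t ∈ Set.Ioi (0:ℝ), μ {a | t < f a} * ENNReal.ofReal t ≤
      ENNReal.ofReal (2 * K * 4 ^ d) * ∫⁻ x, ENNReal.ofReal (g x - t / K / 2) ∂μ := by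
    intro t ht
    have ht : 0 < t := ht
    have := weak_type μ g hgi hg0 (t / K) (by positivity) {a | t < f a} (by
      intro x hx
      by_contra! hcon
      have := h x (t / K) (by positivity) hcon
      rw [mul_div_cancel₀ _ hK.ne'] at this
      exact absurd hx (not_lt.2 this))
    calc μ {a | t < f a} * ENNReal.ofReal t 
        = ENNReal.ofReal (2 * K) * (ENNReal.ofReal (t / K / 2) * μ {a | t < f a}) := by
          rw [← mul_assoc, ← ENNReal.ofReal_mul (by positivity), mul_comm]
          congr 2
          field_simp
      _ ≤ ENNReal.ofReal (2 * K) * (4 ^ d * ∫⁻ x, ENNReal.ofReal (g x - t / K / 2) ∂μ) := by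
          gcongr
      _ = _ := by
          rw [← mul_assoc, ENNReal.ofReal_mul (by positivity : 0 ≤ 2 * K), ENNReal.ofReal_pow (by norm_num)]
          simp
  have hmeas : Measurable (Function.uncurry fun (t : ℝ) (x : E) => ENNReal.ofReal (g x - t / K / 2)) := by
    unfold Function.uncurry
    fun_prop
  calc 2 * ∫⁻ t in Set.Ioi (0:ℝ), μ {a | t < f a} * ENNReal.ofReal t
      ≤ 2 * ∫⁻ t in Set.Ioi (0:ℝ), ENNReal.ofReal (2 * K * 4 ^ d) * 
          ∫⁻ x, ENNReal.ofReal (g x - t / K / 2) ∂μ := by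
        gcongr 2 * ?_
        exact setLIntegral_mono' measurableSet_Ioi step
    _ = 2 * ENNReal.ofReal (2 * K * 4 ^ d) * ∫⁻ x, (∫⁻ t in Set.Ioi (0:ℝ),
          ENNReal.ofReal (g x - t / K / 2)) ∂μ := by
        rw [lintegral_const_mul' _ _ ENNReal.ofReal_ne_top, lintegral_lintegral_swap hmeas.aemeasurable,
          ← mul_assoc]
    _ ≤ 2 * ENNReal.ofReal (2 * K * 4 ^ d) * ∫⁻ x, ENNReal.ofReal (2 * K) * ENNReal.ofReal (g x ^ 2) ∂μ := by
        gcongr 2 * ENNReal.ofReal (2 * K * 4 ^ d) * ?_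
        refine lintegral_mono fun x => ?_
        calc ∫⁻ t in Set.Ioi (0:ℝ), ENNReal.ofReal (g x - t / K / 2)
            ≤ ∫⁻ t in Set.Ioi (0:ℝ), (Set.Ioo 0 (2 * K * g x)).indicator (fun _ => ENNReal.ofReal (g x)) t := by
              refine setLIntegral_mono' measurableSet_Ioi fun t ht => ?_
              have ht : 0 < t := ht
              by_cases hm : t < 2 * K * g x
              · rw [Set.indicator_of_mem (show t ∈ Set.Ioo 0 (2 * K * g x) from ⟨ht, hm⟩)]
                apply ENNReal.ofReal_le_ofReal
                have : 0 < t / K / 2 := by positivity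
                linarith
              · rw [Set.indicator_of_notMem (fun h => hm h.2), ENNReal.ofReal_of_nonpos]
                rw [sub_nonpos, div_div, le_div_iff₀ (by positivity)]
                linarith
          _ ≤ ∫⁻ t, (Set.Ioo 0 (2 * K * g x)).indicator (fun _ => ENNReal.ofReal (g x)) t :=
              setLIntegral_le_lintegral _ _
          _ = ENNReal.ofReal (2 * K) * ENNReal.ofReal (g x ^ 2) := by
              rw [lintegral_indicator_const measurableSet_Ioo, Real.volume_Ioo, 
                ← ENNReal.ofReal_mul (hg0 x), ← ENNReal.ofReal_mul (by positivity)]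
              congr 1
              ring
    _ = _ := by
        rw [lintegral_const_mul' _ _ ENNReal.ofReal_ne_top, ← mul_assoc]
        congr 1
        rw [mul_assoc, ← ENNReal.ofReal_mul (by positivity), 
          show (2 : ℝ≥0∞) = ENNReal.ofReal 2 by simp, ← ENNReal.ofReal_mul (by positivity)]
        congr 1
        ring


/-- `Φ z = |z|^{p-1} z`. -/
noncomputable def Phi {V : Type*} [NormedAddCommGroup V] [NormedSpace ℝ V] (p : ℝ) (z : V) : V :=
  ‖z‖ ^ (p - 1) • z

section
variable {V : Type*} [NormedAddCommGroup V] [NormedSpace ℝ V]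

theorem norm_Phi {p : ℝ} (hp : 1 ≤ p) (z : V) : ‖Phi p z‖ = ‖z‖ ^ p := by
  unfold Phi
  rw [norm_smul, Real.norm_of_nonneg (by positivity)]
  rcases eq_or_ne ‖z‖ 0 with h | h
  · rw [h, mul_zero, Real.zero_rpow (by linarith)]
  · rw [← Real.rpow_add_one h]; simp

theorem Phi_continuous {p : ℝ} (hp : 1 ≤ p) : Continuous (Phi p : V → V) := by
  unfold Phi
  exact (continuous_norm.rpow_const fun _ => Or.inr (by linarith)).smul continuous_id

theorem rpow_mul_self' {p : ℝ} (hp : 1 ≤ p) {a : ℝ} (ha : 0 ≤ a) : a ^ (p - 1) * a = a ^ p := by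
  rcases eq_or_lt_of_le ha with h | h
  · rw [← h, mul_zero, Real.zero_rpow (by linarith)]
  · rw [← Real.rpow_add_one h.ne']; simp

theorem Phi_lower_aux {p : ℝ} (hp : 1 ≤ p) (a b : V) (hab : ‖b‖ ≤ ‖a‖) :
    ‖a - b‖ ^ p ≤ 2 ^ p * ‖Phi p a - Phi p b‖ := by
  have hp0 : 0 ≤ p - 1 := by linarith
  set α := ‖a‖ ^ (p - 1) with hα
  set β := ‖b‖ ^ (p - 1) with hβ
  have hβ0 : 0 ≤ β := by positivity
  have hα0 : 0 ≤ α := by positivity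
  have hβα : β ≤ α := Real.rpow_le_rpow (norm_nonneg _) hab hp0
  have e1 : α • (a - b) = (Phi p a - Phi p b) - (α - β) • b := by
    unfold Phi; module
  have e2 : α * ‖a - b‖ ≤ ‖Phi p a - Phi p b‖ + (α - β) * ‖b‖ := by
    have := congrArg norm e1
    rw [norm_smul, Real.norm_of_nonneg hα0] at this
    rw [this]
    refine (norm_sub_le _ _).trans ?_
    rw [norm_smul, Real.norm_of_nonneg (by linarith)]
  have e3 : (α - β) * ‖b‖ ≤ ‖Phi p a - Phi p b‖ := by
    refine le_trans ?_ (norm_sub_norm_le _ _)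
    rw [norm_Phi hp, norm_Phi hp, ← rpow_mul_self' hp (norm_nonneg a),
      ← rpow_mul_self' hp (norm_nonneg b)]
    nlinarith
  have e4 : ‖a - b‖ ^ (p - 1) ≤ 2 ^ (p - 1) * α := by
    rw [hα, ← Real.mul_rpow (by norm_num) (norm_nonneg _)]
    refine Real.rpow_le_rpow (norm_nonneg _) ?_ hp0
    linarith [norm_sub_le a b]
  rw [← rpow_mul_self' hp (norm_nonneg (a - b)), ← rpow_mul_self' hp (by norm_num : (0:ℝ) ≤ 2)]
  have h2 : (0:ℝ) < 2 ^ (p - 1) := by positivity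
  calc ‖a - b‖ ^ (p - 1) * ‖a - b‖ ≤ 2 ^ (p - 1) * α * ‖a - b‖ := by gcongr
    _ = 2 ^ (p - 1) * (α * ‖a - b‖) := by ring
    _ ≤ 2 ^ (p - 1) * (2 * ‖Phi p a - Phi p b‖) :=
        mul_le_mul_of_nonneg_left (by linarith) h2.le
    _ = _ := by ring

theorem Phi_lower {p : ℝ} (hp : 1 ≤ p) (a b : V) :
    ‖a - b‖ ^ p ≤ 2 ^ p * ‖Phi p a - Phi p b‖ := by
  rcases le_total ‖b‖ ‖a‖ with h | h
  · exact Phi_lower_aux hp a b h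
  · rw [norm_sub_rev a b, norm_sub_rev (Phi p a)]
    exact Phi_lower_aux hp b a h

theorem rpow_sub_le {p : ℝ} (hp : 1 ≤ p) {a b : ℝ} (hb : 0 ≤ b) (hab : b ≤ a) :
    a ^ p - b ^ p ≤ p * a ^ (p - 1) * (a - b) := by
  rcases eq_or_lt_of_le hab with h | h
  · rw [h]; simp
  have hc := convexOn_rpow hp
  have ha : 0 < a := lt_of_le_of_lt hb h
  have hd : HasDerivAt (fun x : ℝ => x ^ p) (p * a ^ (p - 1)) a :=
    Real.hasDerivAt_rpow_const (Or.inl ha.ne')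
  have := hc.slope_le_of_hasDerivAt (x := b) (y := a) hb ha.le h hd
  rw [slope_def_field, div_le_iff₀ (by linarith)] at this
  exact this

theorem Phi_upper_aux {p : ℝ} (hp : 1 ≤ p) (a b : V) (hab : ‖b‖ ≤ ‖a‖) :
    ‖Phi p a - Phi p b‖ ≤ (1 + p) * ‖a‖ ^ (p - 1) * ‖a - b‖ := by
  have hp0 : 0 ≤ p - 1 := by linarith
  have h0 := rpow_sub_le hp (norm_nonneg b) hab
  rw [← rpow_mul_self' hp (norm_nonneg a), ← rpow_mul_self' hp (norm_nonneg b)] at h0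
  have e1 : Phi p a - Phi p b = ‖a‖ ^ (p - 1) • (a - b) + (‖a‖ ^ (p - 1) - ‖b‖ ^ (p - 1)) • b := by
    unfold Phi; module
  set α := ‖a‖ ^ (p - 1) with hα
  set β := ‖b‖ ^ (p - 1) with hβ
  have hα0 : 0 ≤ α := by positivity
  have hβα : β ≤ α := Real.rpow_le_rpow (norm_nonneg _) hab hp0
  rw [e1]
  refine (norm_add_le _ _).trans ?_
  rw [norm_smul, norm_smul, Real.norm_of_nonneg hα0, Real.norm_of_nonneg (by linarith : 0 ≤ α - β)]
  have h3 : (α - β) * ‖b‖ ≤ α * ‖a‖ - β * ‖b‖ := by nlinarith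
  have h4 : p * α * (‖a‖ - ‖b‖) ≤ p * α * ‖a - b‖ := by
    gcongr; exact norm_sub_norm_le a b
  linarith

theorem Phi_upper {p : ℝ} (hp : 1 ≤ p) (a b : V) :
    ‖Phi p a - Phi p b‖ ≤ (1 + p) * (max ‖a‖ ‖b‖) ^ (p - 1) * ‖a - b‖ := by
  rcases le_total ‖b‖ ‖a‖ with h | h
  · rw [max_eq_left h]; exact Phi_upper_aux hp a b h
  · rw [norm_sub_rev a b, norm_sub_rev (Phi p a), max_eq_right h]
    exact Phi_upper_aux hp b a h

open Filter Topology in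
/-- path estimate for `Φ ∘ f`. -/
theorem Phi_path {p : ℝ} (hp : 1 ≤ p) (f f' : ℝ → V) (hf : ∀ t, HasDerivAt f (f' t) t)
    (hf' : Continuous f') :
    ‖Phi p (f 1) - Phi p (f 0)‖ ≤ ∫ t in (0:ℝ)..1, (1 + p) * (‖f t‖ ^ (p - 1) * ‖f' t‖) := by
  have hp0 : 0 ≤ p - 1 := by linarith
  have hfc : Continuous f := continuous_iff_continuousAt.2 fun t => (hf t).continuousAt
  have hB'c : Continuous fun t => (1 + p) * (‖f t‖ ^ (p - 1) * ‖f' t‖) := by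
    exact continuous_const.mul ((hfc.norm.rpow_const fun _ => Or.inr hp0).mul hf'.norm)
  have hBd : ∀ x, HasDerivAt (fun s => ∫ t in (0:ℝ)..s, (1 + p) * (‖f t‖ ^ (p - 1) * ‖f' t‖))
      ((1 + p) * (‖f x‖ ^ (p - 1) * ‖f' x‖)) x := fun x =>
    intervalIntegral.integral_hasDerivAt_right (hB'c.intervalIntegrable _ _)
      (hB'c.stronglyMeasurableAtFilter _ _) hB'c.continuousAt
  have hcont : Continuous fun t => Phi p (f t) - Phi p (f 0) :=
    ((Phi_continuous hp).comp hfc).sub continuous_const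
  refine image_le_of_liminf_slope_right_le_deriv_boundary
    (f := fun t => ‖Phi p (f t) - Phi p (f 0)‖) (a := 0) (b := 1)
    (B := fun s => ∫ t in (0:ℝ)..s, (1 + p) * (‖f t‖ ^ (p - 1) * ‖f' t‖))
    (B' := fun x => (1 + p) * (‖f x‖ ^ (p - 1) * ‖f' x‖))
    hcont.norm.continuousOn (by simp) 
    (continuous_iff_continuousAt.2 fun t => (hBd t).continuousAt).continuousOn
    (fun x _ => (hBd x).hasDerivWithinAt) ?_ (Set.right_mem_Icc.2 zero_le_one)
  intro x _ r hr
  apply Eventually.frequently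
  have hlim : Tendsto (fun z => (1 + p) * ((max ‖f z‖ ‖f x‖) ^ (p - 1) * ‖slope f x z‖)) (𝓝[>] x)
      (𝓝 ((1 + p) * (‖f x‖ ^ (p - 1) * ‖f' x‖))) := by
    refine Tendsto.const_mul _ (Tendsto.mul ?_ ?_)
    · have : Continuous fun z => (max ‖f z‖ ‖f x‖) ^ (p - 1) :=
        (hfc.norm.max continuous_const).rpow_const fun _ => Or.inr hp0
      have := this.tendsto x
      rw [max_self] at this
      exact this.mono_left nhdsWithin_le_nhds
    · refine Tendsto.norm ?_
      exact (hasDerivAt_iff_tendsto_slope.1 (hf x)).mono_left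
        (nhdsWithin_mono _ fun z hz => ne_of_gt hz)
  filter_upwards [hlim.eventually_lt_const hr, self_mem_nhdsWithin] with z hz hxz
  refine lt_of_le_of_lt ?_ hz
  have hxz : x < z := hxz
  rw [slope_def_field, div_le_iff₀ (by linarith)]
  calc ‖Phi p (f z) - Phi p (f 0)‖ - ‖Phi p (f x) - Phi p (f 0)‖
      ≤ ‖Phi p (f z) - Phi p (f x)‖ := by
        refine (norm_sub_norm_le _ _).trans (le_of_eq ?_)
        congr 1; abel
    _ ≤ (1 + p) * (max ‖f z‖ ‖f x‖) ^ (p - 1) * ‖f z - f x‖ := Phi_upper hp _ _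
    _ = _ := by
        have : f z - f x = (z - x) • slope f x z := by simp [sub_smul_slope]
        rw [this, norm_smul, Real.norm_of_nonneg (by linarith)]
        ring

end

section
variable {E : Type*} [NormedAddCommGroup E] [NormedSpace ℝ E] [MeasurableSpace E]
    [BorelSpace E] [FiniteDimensional ℝ E] (μ : Measure E) [μ.IsAddHaarMeasure]

theorem int_scale (x : E) (g : E → ℝ) (t R : ℝ) (ht : 0 < t) :
    ∫ y in ball x R, g (x + t • (y - x)) ∂μ =
      (t ^ Module.finrank ℝ E)⁻¹ * ∫ y in ball x (t * R), g y ∂μ := by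
  have h1 : ∀ (F : E → ℝ) (r : ℝ), ∫ y in ball x r, F y ∂μ = ∫ h in ball (0:E) r, F (x + h) ∂μ := by
    intro F r
    have hmp := (measurePreserving_add_left μ x)
    rw [← hmp.setIntegral_preimage_emb (measurableEmbedding_addLeft x)]
    congr 2
    ext h
    simp [mem_ball, dist_eq_norm]
  rw [h1, h1]
  simp only [add_sub_cancel_left]
  rw [Measure.setIntegral_comp_smul_of_pos μ (fun h => g (x + h)) _ ht, smul_eq_mul,
    _root_.smul_ball ht.ne', smul_zero, Real.norm_of_nonneg ht.le]

theorem path_avg {W : Type*} [NormedAddCommGroup W] (x : E) (w : E → W) (hw : Continuous w)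
    (g : E → ℝ) (hg : Continuous g) (hg0 : ∀ y, 0 ≤ g y)
    (K R l : ℝ) (hK : 0 ≤ K) (hR : 0 < R)
    (hpath : ∀ y, ‖w y - w x‖ ≤ K * ‖y - x‖ * ∫ t in (0:ℝ)..1, g (x + t • (y - x)))
    (havg : ∀ r, 0 < r → r ≤ R → ∫ y in ball x r, g y ∂μ ≤ l * μ.real (ball x r)) :
    ∫ y in ball x R, ‖w y - w x‖ ∂μ ≤ K * R * l * μ.real (ball x R) := by
  set d := Module.finrank ℝ E with hd
  have hloc : ∀ f : E → ℝ, Continuous f → IntegrableOn f (ball x R) μ := fun f hf =>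
    (hf.continuousOn.integrableOn_compact (isCompact_closedBall x R)).mono_set ball_subset_closedBall
  have hjc : Continuous fun q : ℝ × E => g (x + q.1 • (q.2 - x)) := by fun_prop
  have hIc : Continuous fun y : E => ∫ t in (0:ℝ)..1, g (x + t • (y - x)) :=
    intervalIntegral.continuous_parametric_intervalIntegral_of_continuous' (by fun_prop) _ _
  have hInn : ∀ y, 0 ≤ ∫ t in (0:ℝ)..1, g (x + t • (y - x)) := fun y =>
    intervalIntegral.integral_nonneg zero_le_one fun t _ => hg0 _
  have hint : Integrable (Function.uncurry fun (t : ℝ) (y : E) => g (x + t • (y - x)))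
      ((volume.restrict (Set.uIoc (0:ℝ) 1)).prod (μ.restrict (ball x R))) := by
    rw [Measure.prod_restrict]
    have hc : IsCompact ((Set.Icc (0:ℝ) 1) ×ˢ closedBall x R) :=
      isCompact_Icc.prod (isCompact_closedBall x R)
    refine (ContinuousOn.integrableOn_compact (μ := volume.prod μ) hc hjc.continuousOn).mono_set ?_
    refine Set.prod_mono ?_ ball_subset_closedBall
    rw [Set.uIoc_of_le zero_le_one]
    exact Set.Ioc_subset_Icc_self
  have hswap := intervalIntegral_integral_swap hint
  have hball : ∀ t : ℝ, 0 < t → μ.real (ball x (t * R)) = t ^ d * μ.real (ball x R) := by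
    intro t ht
    rw [Measure.real, Measure.addHaar_ball_mul_of_pos μ _ ht, ENNReal.toReal_mul,
      ENNReal.toReal_ofReal (by positivity), Measure.real, Measure.addHaar_ball_center μ x R]
  have hinner : ∀ t ∈ Set.Ioc (0:ℝ) 1, ∫ y in ball x R, g (x + t • (y - x)) ∂μ ≤ l * μ.real (ball x R) := by
    intro t ht
    rw [int_scale μ x g t R ht.1]
    have h1 := havg (t * R) (mul_pos ht.1 hR) (by nlinarith [ht.2])
    rw [hball t ht.1] at h1
    have htd : 0 < t ^ d := pow_pos ht.1 _
    rw [inv_mul_le_iff₀ htd]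
    linarith
  calc ∫ y in ball x R, ‖w y - w x‖ ∂μ
      ≤ ∫ y in ball x R, ((K * R) * ∫ t in (0:ℝ)..1, g (x + t • (y - x))) ∂μ := by
        refine setIntegral_mono_on (hloc _ (by fun_prop)) (hloc _ (by fun_prop)) measurableSet_ball ?_
        intro y hy
        refine (hpath y).trans ?_
        have := hInn y
        have : ‖y - x‖ ≤ R := by rw [← dist_eq_norm]; exact (mem_ball.1 hy).le
        gcongr
    _ = K * R * ∫ t in (0:ℝ)..1, ∫ y in ball x R, g (x + t • (y - x)) ∂μ := by
        rw [hswap, integral_const_mul]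
    _ ≤ K * R * (l * μ.real (ball x R)) := by
        gcongr
        rw [intervalIntegral.integral_of_le zero_le_one]
        have hi : IntegrableOn (fun t : ℝ => ∫ y in ball x R, g (x + t • (y - x)) ∂μ) (Set.Ioc 0 1) volume := by
          have := hint.integral_prod_left
          rw [Set.uIoc_of_le zero_le_one] at this
          exact this
        refine (setIntegral_mono_on hi (integrableOn_const (μ := volume) (by simp)) measurableSet_Ioc hinner).trans ?_
        simp
    _ = _ := by ring

end
section
variable {E : Type*} [NormedAddCommGroup E] [NormedSpace ℝ E] [MeasurableSpace E]
    [BorelSpace E] [FiniteDimensional ℝ E] (μ : Measure E) [μ.IsAddHaarMeasure]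
    {F : Type*} [NormedAddCommGroup F] [NormedSpace ℝ F]

theorem affine_lower (x : E) (R : ℝ) (hR : 0 < R) (S : Set E) (hS : MeasurableSet S)
    (hSB : S ⊆ ball x R)
    (hmeas : 2 ^ (Module.finrank ℝ E + 2) * μ.real (ball x R \ S) ≤ μ.real (ball x R))
    (A : E →L[ℝ] F) (c : F) :
    ‖A‖ * R * μ.real (ball x R) ≤
      2 ^ (Module.finrank ℝ E + 4) * ∫ y in S, ‖c - A (y - x)‖ ∂μ := by
  set d := Module.finrank ℝ E with hd
  set B := ball x R with hB
  have hint0 : 0 ≤ ∫ y in S, ‖c - A (y - x)‖ ∂μ := integral_nonneg fun _ => norm_nonneg _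
  rcases eq_or_lt_of_le (norm_nonneg A) with hA | hA
  · rw [← hA]; simp only [zero_mul]; positivity
  obtain ⟨v, hv1, hvA⟩ := A.exists_lt_apply_of_lt_opNorm (half_lt_self hA)
  set τ : E := (R / 2) • v with hτ
  have hτn : ‖τ‖ ≤ R / 2 := by
    rw [hτ, norm_smul, Real.norm_of_nonneg (by positivity)]; nlinarith
  have hAτ : R / 4 * ‖A‖ ≤ ‖A τ‖ := by
    rw [hτ, map_smul, norm_smul, Real.norm_of_nonneg (by positivity)]; nlinarith
  have hmp : MeasurePreserving (fun y : E => y + τ) μ μ := measurePreserving_add_right μ τ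
  have hme : MeasurableEmbedding (fun y : E => y + τ) := measurableEmbedding_addRight τ
  set S' := (fun y : E => y + τ) ⁻¹' S with hS'
  have hS'm : MeasurableSet S' := hmp.measurable hS
  set T := S ∩ S' with hT
  have hBfin : μ B ≠ ∞ := measure_ball_lt_top.ne
  have hSfin : μ S ≠ ∞ := (measure_mono hSB |>.trans_lt measure_ball_lt_top).ne
  have hDfin : μ (B \ S) ≠ ∞ := (measure_mono Set.sdiff_subset |>.trans_lt measure_ball_lt_top).ne
  have hTfin : μ T ≠ ∞ := (measure_mono Set.inter_subset_left |>.trans_lt hSfin.lt_top).ne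
  have hpre : μ.real ((fun y : E => y + τ) ⁻¹' (B \ S)) = μ.real (B \ S) := by
    rw [Measure.real, hmp.measure_preimage_emb hme, Measure.real]
  have hpref : μ ((fun y : E => y + τ) ⁻¹' (B \ S)) ≠ ∞ := by
    rwa [hmp.measure_preimage_emb hme]
  have hcover : ball x (R / 2) ⊆ T ∪ ((B \ S) ∪ (fun y : E => y + τ) ⁻¹' (B \ S)) := by
    intro y hy
    have hy' : dist y x < R / 2 := hy
    have h1 : y ∈ B := by rw [hB, mem_ball]; linarith
    have h2 : y + τ ∈ B := by
      rw [hB, mem_ball, dist_eq_norm, show y + τ - x = (y - x) + τ by abel]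
      rw [dist_eq_norm] at hy'
      linarith [norm_add_le (y - x) τ]
    by_cases h3 : y ∈ S
    · by_cases h4 : y + τ ∈ S
      · exact Or.inl ⟨h3, h4⟩
      · exact Or.inr (Or.inr ⟨h2, h4⟩)
    · exact Or.inr (Or.inl ⟨h1, h3⟩)
  have hhalf : 2 ^ d * μ.real (ball x (R / 2)) = μ.real B := by
    rw [hB, Measure.real, Measure.real, Measure.addHaar_ball_of_pos μ x (by positivity : 0 < R / 2),
      Measure.addHaar_ball_of_pos μ x hR, ENNReal.toReal_mul, ENNReal.toReal_mul,
      ENNReal.toReal_ofReal (by positivity), ENNReal.toReal_ofReal (by positivity), ← mul_assoc,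
      ← mul_pow]
    congr 2; ring
  have hTbig : μ.real B ≤ 2 ^ (d + 1) * μ.real T := by
    have h1 : μ.real (ball x (R / 2)) ≤ μ.real T + (μ.real (B \ S) + μ.real (B \ S)) := by
      refine (measureReal_mono hcover ?_).trans ((measureReal_union_le _ _).trans ?_)
      · exact (measure_union_lt_top hTfin.lt_top
          (measure_union_lt_top hDfin.lt_top hpref.lt_top)).ne
      · gcongr
        exact (measureReal_union_le _ _).trans (by rw [hpre])
    have h2 : (0:ℝ) < 2 ^ d := by positivity
    rw [pow_add] at hmeas ⊢
    nlinarith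
  have hcont : Continuous fun y => ‖c - A (y - x)‖ := by fun_prop
  have hcont' : Continuous fun y => ‖c - A (y + τ - x)‖ := by fun_prop
  have hiS : IntegrableOn (fun y => ‖c - A (y - x)‖) S μ :=
    (hcont.continuousOn.integrableOn_compact (isCompact_closedBall x R)).mono_set
      (hSB.trans ball_subset_closedBall)
  have hiS' : IntegrableOn (fun y => ‖c - A (y + τ - x)‖) S' μ :=
    (hmp.integrableOn_comp_preimage hme (f := fun y => ‖c - A (y - x)‖)).2 hiS
  have hS'int : ∫ y in S', ‖c - A (y + τ - x)‖ ∂μ = ∫ y in S, ‖c - A (y - x)‖ ∂μ :=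
    hmp.setIntegral_preimage_emb hme (fun y => ‖c - A (y - x)‖) S
  have hkey : ‖A τ‖ * μ.real T ≤ 2 * ∫ y in S, ‖c - A (y - x)‖ ∂μ := by
    calc ‖A τ‖ * μ.real T = ∫ y in T, ‖A τ‖ ∂μ := by simp [mul_comm]
      _ ≤ ∫ y in T, (‖c - A (y - x)‖ + ‖c - A (y + τ - x)‖) ∂μ := by
          refine setIntegral_mono_on (integrableOn_const hTfin)
            ((hiS.mono_set Set.inter_subset_left).add (hiS'.mono_set Set.inter_subset_right))
            (hS.inter hS'm) fun y _ => ?_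
          have : A τ = (c - A (y - x)) - (c - A (y + τ - x)) := by
            rw [show y + τ - x = (y - x) + τ by abel, map_add]; abel
          rw [this]; exact norm_sub_le _ _
      _ = ∫ y in T, ‖c - A (y - x)‖ ∂μ + ∫ y in T, ‖c - A (y + τ - x)‖ ∂μ :=
          integral_add (hiS.mono_set Set.inter_subset_left) (hiS'.mono_set Set.inter_subset_right)
      _ ≤ ∫ y in S, ‖c - A (y - x)‖ ∂μ + ∫ y in S', ‖c - A (y + τ - x)‖ ∂μ := by
          refine add_le_add ?_ ?_
          · exact setIntegral_mono_set hiS (Filter.Eventually.of_forall fun _ => norm_nonneg _)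
              (LE.le.eventuallyLE Set.inter_subset_left)
          · exact setIntegral_mono_set hiS' (Filter.Eventually.of_forall fun _ => norm_nonneg _)
              (LE.le.eventuallyLE Set.inter_subset_right)
      _ = _ := by rw [hS'int]; ring
  have hT0 : 0 ≤ μ.real T := measureReal_nonneg
  calc ‖A‖ * R * μ.real B ≤ ‖A‖ * R * (2 ^ (d + 1) * μ.real T) := by gcongr
    _ = 2 ^ (d + 3) * ((R / 4 * ‖A‖) * μ.real T) := by ring
    _ ≤ 2 ^ (d + 3) * (‖A τ‖ * μ.real T) := by gcongr
    _ ≤ 2 ^ (d + 3) * (2 * ∫ y in S, ‖c - A (y - x)‖ ∂μ) := by gcongr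
    _ = _ := by ring

theorem young_aux {p : ℝ} (hp : 1 ≤ p) {t k : ℝ} (ht : 0 ≤ t) (hk : 0 < k) :
    t ≤ k + k ^ (1 - p) * t ^ p := by
  rcases le_total t k with h | h
  · have : 0 ≤ k ^ (1 - p) * t ^ p := by positivity
    linarith
  · have h1 : k ^ (1 - p) * k ^ (p - 1) = 1 := by
      rw [← Real.rpow_add hk]; simp
    have h2 : k ^ (p - 1) ≤ t ^ (p - 1) := Real.rpow_le_rpow hk.le h (by linarith)
    have h3 : t ≤ k ^ (1 - p) * t ^ p := by
      rw [← rpow_mul_self' hp ht, ← mul_assoc]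
      have : 1 ≤ k ^ (1 - p) * t ^ (p - 1) := by
        exact h1.ge.trans (mul_le_mul_of_nonneg_left h2 (by positivity))
      nlinarith
    linarith

theorem norm_D2 {E F : Type*} [NormedAddCommGroup E] [NormedSpace ℝ E] [NormedAddCommGroup F]
    [NormedSpace ℝ F] (u : E → F) (y : E) :
    ‖fderiv ℝ (fderiv ℝ u) y‖ = ‖iteratedFDeriv ℝ 2 u y‖ := by
  rw [← norm_iteratedFDeriv_one, norm_iteratedFDeriv_fderiv]

variable [CompleteSpace F]

/-- The constant in the pointwise estimate. -/
noncomputable def KK (d : ℕ) (p : ℝ) : ℝ :=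
  (1 + p) * (4 * 2 ^ (d + 4)) * ((16 * 2 ^ (d + 4)) ^ p + 2 ^ (d + 4))

theorem KK_pos (d : ℕ) {p : ℝ} (hp : 1 ≤ p) : 0 < KK d p := by
  unfold KK; positivity

theorem pointwise {p : ℝ} (hp : 1 ≤ p) (Ω : Set E) (hΩ : MeasurableSet Ω) (u : E → F)
    (hu : ContDiff ℝ 2 u) (hu0 : ∀ y, y ∉ Ω → fderiv ℝ u y = 0) (x : E)
    (b : ℝ) (hb : 0 < b)
    (hosc : ∀ R > 0, ∃ c, ∫ y in Ω ∩ ball x R, ‖u y - c‖ ∂μ ≤ b * μ.real (Ω ∩ ball x R))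
    (l : ℝ) (hl : 0 < l)
    (hmax : ∀ r > 0, ∫ y in ball x r, ‖fderiv ℝ u y‖ ^ (p - 1) * ‖fderiv ℝ (fderiv ℝ u) y‖ ∂μ
      ≤ l * μ.real (ball x r)) :
    ‖fderiv ℝ u x‖ ^ (p + 1) ≤ KK (Module.finrank ℝ E) p * b * l := by
  set d := Module.finrank ℝ E with hd
  have hp0 : 0 ≤ p - 1 := by linarith
  by_contra! hcon
  set A := fderiv ℝ u x with hA
  set a := ‖A‖ with ha
  have ha0 : 0 ≤ a := norm_nonneg _
  have hapos : 0 < a := by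
    rcases eq_or_lt_of_le ha0 with h | h
    · rw [← h, Real.zero_rpow (by linarith)] at hcon
      have := KK_pos d hp
      have : 0 < KK d p * b * l := by positivity
      linarith
    · exact h
  have hud : Differentiable ℝ u := hu.differentiable (by norm_num)
  have hDu : ContDiff ℝ 1 (fderiv ℝ u) := hu.fderiv_right (by norm_num)
  have hDud : Differentiable ℝ (fderiv ℝ u) := hDu.differentiable (by norm_num)
  have hDuc : Continuous (fderiv ℝ u) := hDu.continuous
  have hD2c : Continuous (fderiv ℝ (fderiv ℝ u)) := hDu.continuous_fderiv (by norm_num)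
  set g : E → ℝ := fun y => ‖fderiv ℝ u y‖ ^ (p - 1) * ‖fderiv ℝ (fderiv ℝ u) y‖ with hg
  have hD2n : Continuous fun y => ‖fderiv ℝ (fderiv ℝ u) y‖ := by
    simp only [norm_D2]
    exact (hu.continuous_iteratedFDeriv (by norm_num)).norm
  have hgc : Continuous g := (hDuc.norm.rpow_const fun _ => Or.inr hp0).mul hD2n
  have hg0 : ∀ y, 0 ≤ g y := fun y => by positivity
  set w : E → (E →L[ℝ] F) := fun y => Phi p (fderiv ℝ u y) with hw
  have hwc : Continuous w := (Phi_continuous hp).comp hDuc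
  -- path estimates
  have hline : ∀ (y : E) (t : ℝ), HasDerivAt (fun t : ℝ => x + t • (y - x)) (y - x) t := by
    intro y t
    simpa using ((hasDerivAt_id t).smul_const (y - x)).const_add x
  have hpath1 : ∀ y, ‖w y - w x‖ ≤ (1 + p) * ‖y - x‖ * ∫ t in (0:ℝ)..1, g (x + t • (y - x)) := by
    intro y
    have h1 := Phi_path hp (fun t : ℝ => fderiv ℝ u (x + t • (y - x)))
      (fun t => fderiv ℝ (fderiv ℝ u) (x + t • (y - x)) (y - x))
      (fun t => (hDud _).hasFDerivAt.comp_hasDerivAt t (hline y t)) (by fun_prop)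
    simp only [one_smul, zero_smul, add_zero, add_sub_cancel] at h1
    refine h1.trans ?_
    rw [← intervalIntegral.integral_const_mul]
    refine intervalIntegral.integral_mono_on zero_le_one ?_ ?_ fun t _ => ?_
    · apply Continuous.intervalIntegrable
      refine continuous_const.mul (Continuous.mul ?_ (by fun_prop))
      exact Continuous.rpow_const (by fun_prop) fun _ => Or.inr hp0
    · apply Continuous.intervalIntegrable; fun_prop
    · have h2 := (fderiv ℝ (fderiv ℝ u) (x + t • (y - x))).le_opNorm (y - x)
      have h3 : 0 ≤ (1 + p) * ‖fderiv ℝ u (x + t • (y - x))‖ ^ (p - 1) := by positivity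
      simp only [hg]
      nlinarith [mul_le_mul_of_nonneg_left h2 h3]
  have hpath2 : ∀ y, ‖(u y - A (y - x)) - (u x - A (x - x))‖ ≤
      1 * ‖y - x‖ * ∫ t in (0:ℝ)..1, ‖fderiv ℝ u (x + t • (y - x)) - A‖ := by
    intro y
    have hder : ∀ t ∈ Set.uIcc (0:ℝ) 1, HasDerivAt
        (fun t : ℝ => u (x + t • (y - x)) - t • A (y - x))
        ((fderiv ℝ u (x + t • (y - x)) - A) (y - x)) t := by
      intro t _
      have h1 := (hud (x + t • (y - x))).hasFDerivAt.comp_hasDerivAt t (hline y t)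
      have h2 := (hasDerivAt_id t).smul_const (A (y - x))
      have h3 := h1.sub h2
      rw [one_smul] at h3
      exact h3
    have hftc := intervalIntegral.integral_eq_sub_of_hasDerivAt hder
      (Continuous.intervalIntegrable (by fun_prop) _ _)
    simp only [one_smul, zero_smul, add_zero, add_sub_cancel, sub_zero] at hftc
    have e : (u y - A (y - x)) - (u x - A (x - x)) = u y - A (y - x) - u x := by simp
    rw [e, ← hftc, one_mul, ← intervalIntegral.integral_const_mul]
    refine (intervalIntegral.norm_integral_le_integral_norm zero_le_one).trans ?_
    refine intervalIntegral.integral_mono_on zero_le_one ?_ ?_ fun t _ => ?_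
    · apply Continuous.intervalIntegrable; fun_prop
    · apply Continuous.intervalIntegrable; fun_prop
    · rw [mul_comm]; exact ContinuousLinearMap.le_opNorm _ _
  -- parameters
  set N : ℝ := 2 ^ (d + 4) with hN
  have hNpos : 0 < N := by positivity
  set R : ℝ := 4 * N * b / a with hRdef
  have hR : 0 < R := by positivity
  have haR : a * R = 4 * N * b := by rw [hRdef]; field_simp
  set k : ℝ := a / (8 * N) with hkdef
  have hk : 0 < k := by positivity
  have hap1 : a ^ (p + 1) = a ^ p * a := Real.rpow_add_one hapos.ne' p
  have hapw : 0 < a ^ p := by positivity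
  have hbase : (1 + p) * R * l * ((16 * N) ^ p + N) < a ^ p := by
    have h1 : KK d p * b * l = a * ((1 + p) * R * l * ((16 * N) ^ p + N)) := by
      unfold KK
      calc _ = (1 + p) * (4 * N * b) * l * ((16 * N) ^ p + N) := by rw [hN]; ring
        _ = _ := by rw [← haR]; ring
    rw [h1, hap1] at hcon
    nlinarith
  have hN16 : (0:ℝ) < (16 * N) ^ p := by positivity
  have hX : 0 < (1 + p) * R * l := by positivity
  have hkp : 2 ^ p * ((1 + p) * R * l) ≤ k ^ p := by
    rw [hkdef, Real.div_rpow ha0 (by positivity), le_div_iff₀ (by positivity)]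
    have : (2:ℝ) ^ p * (8 * N) ^ p = (16 * N) ^ p := by
      rw [← Real.mul_rpow (by norm_num) (by positivity)]; ring_nf
    calc 2 ^ p * ((1 + p) * R * l) * (8 * N) ^ p = (1 + p) * R * l * (2 ^ p * (8 * N) ^ p) := by ring
      _ = (1 + p) * R * l * (16 * N) ^ p := by rw [this]
      _ ≤ a ^ p := by nlinarith
  have hint1 : ∀ r > 0, ∫ y in ball x r, ‖w y - w x‖ ∂μ ≤ (1 + p) * r * l * μ.real (ball x r) :=
    fun r hr => path_avg μ x w hwc g hgc hg0 (1 + p) r l (by linarith) hr hpath1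
      fun s hs _ => hmax s hs
  have hloc : ∀ (f : E → ℝ) (r : ℝ), Continuous f → IntegrableOn f (ball x r) μ := fun f r hf =>
    (hf.continuousOn.integrableOn_compact (isCompact_closedBall x r)).mono_set ball_subset_closedBall
  have hBpos : 0 < μ.real (ball x R) :=
    ENNReal.toReal_pos (measure_ball_pos _ _ hR).ne' measure_ball_lt_top.ne
  have havg2 : ∀ r, 0 < r → r ≤ R → 
      ∫ y in ball x r, ‖fderiv ℝ u y - A‖ ∂μ ≤ 2 * k * μ.real (ball x r) := by
    intro r hr hrR
    calc ∫ y in ball x r, ‖fderiv ℝ u y - A‖ ∂μ 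
        ≤ ∫ y in ball x r, (k + (k ^ (1 - p) * 2 ^ p) * ‖w y - w x‖) ∂μ := by
          refine setIntegral_mono_on (hloc _ _ (by fun_prop)) (hloc _ _ (by fun_prop))
            measurableSet_ball fun y _ => ?_
          refine (young_aux hp (norm_nonneg _) hk).trans ?_
          rw [mul_assoc]
          gcongr
          exact Phi_lower hp _ _
      _ = k * μ.real (ball x r) + (k ^ (1 - p) * 2 ^ p) * ∫ y in ball x r, ‖w y - w x‖ ∂μ := by
          rw [integral_add (hloc _ _ (by fun_prop)) (hloc _ _ (by fun_prop)), integral_const_mul]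
          simp [mul_comm]
      _ ≤ k * μ.real (ball x r) + 
          (k ^ (1 - p) * 2 ^ p) * ((1 + p) * R * l * μ.real (ball x r)) := by
          gcongr
          refine (hint1 r hr).trans ?_
          gcongr
      _ = (k + k ^ (1 - p) * (2 ^ p * ((1 + p) * R * l))) * μ.real (ball x r) := by ring
      _ ≤ (k + k ^ (1 - p) * k ^ p) * μ.real (ball x r) := by gcongr
      _ = _ := by
          rw [← Real.rpow_add hk]; simp; ring_nf; simp
  have hint2 : ∫ y in ball x R, ‖(u y - A (y - x)) - (u x - A (x - x))‖ ∂μ ≤ 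
      1 * R * (2 * k) * μ.real (ball x R) :=
    path_avg μ x (fun y => u y - A (y - x)) (by fun_prop) (fun y => ‖fderiv ℝ u y - A‖) 
      (by fun_prop) (fun y => norm_nonneg _) 1 R (2 * k) zero_le_one hR hpath2 havg2
  set S := Ω ∩ ball x R with hS
  have hSm : MeasurableSet S := hΩ.inter measurableSet_ball
  have hSB : S ⊆ ball x R := Set.inter_subset_right
  have hDB : ball x R \ S ⊆ ball x R := Set.sdiff_subset
  by_cases hcase : 2 ^ (d + 2) * μ.real (ball x R \ S) ≤ μ.real (ball x R)
  · obtain ⟨c, hc⟩ := hosc R hR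
    have h1 := affine_lower μ x R hR S hSm hSB hcase A (c - u x)
    have h2 : ∫ y in S, ‖(c - u x) - A (y - x)‖ ∂μ ≤ 
        b * μ.real (ball x R) + 1 * R * (2 * k) * μ.real (ball x R) := by
      calc ∫ y in S, ‖(c - u x) - A (y - x)‖ ∂μ 
          ≤ ∫ y in S, (‖u y - c‖ + ‖(u y - A (y - x)) - (u x - A (x - x))‖) ∂μ := by
            refine setIntegral_mono_on ((hloc _ _ (by fun_prop)).mono_set hSB) 
              ((hloc _ _ (by fun_prop)).mono_set hSB) hSm fun y _ => ?_
            have : (c - u x) - A (y - x) = 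
              ((u y - A (y - x)) - (u x - A (x - x))) - (u y - c) := by
                rw [sub_self x, map_zero]; abel
            rw [this, add_comm]
            exact norm_sub_le _ _
        _ = ∫ y in S, ‖u y - c‖ ∂μ + ∫ y in S, ‖(u y - A (y - x)) - (u x - A (x - x))‖ ∂μ := 
            integral_add ((hloc _ _ (by fun_prop)).mono_set hSB) 
              ((hloc _ _ (by fun_prop)).mono_set hSB)
        _ ≤ b * μ.real (ball x R) + 
            ∫ y in ball x R, ‖(u y - A (y - x)) - (u x - A (x - x))‖ ∂μ := by
            refine add_le_add ?_ ?_
            · refine hc.trans ?_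
              gcongr
              exact measure_ball_lt_top.ne
            · exact setIntegral_mono_set (hloc _ _ (by fun_prop))
                (Filter.Eventually.of_forall fun _ => norm_nonneg _) 
                (LE.le.eventuallyLE hSB)
        _ ≤ _ := by gcongr
    have h3 : a * R * μ.real (ball x R) ≤ N * (b + 2 * R * k) * μ.real (ball x R) := by
      refine h1.trans ?_
      calc _ ≤ N * (b * μ.real (ball x R) + 1 * R * (2 * k) * μ.real (ball x R)) := by gcongr
        _ = _ := by ring
    have h4 := le_of_mul_le_mul_right h3 hBpos
    have h5 : N * k = a / 8 := by rw [hkdef]; field_simp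
    have h6 : N * (b + 2 * R * k) = a * R / 4 + a * R / 4 := by
      calc _ = N * b + 2 * R * (N * k) := by ring
        _ = _ := by rw [h5, haR]; ring_nf; rw [mul_assoc R a, mul_comm R, mul_comm a, mul_comm]; linarith
    have : 0 < a * R := by positivity
    linarith
  · push Not at hcase
    have h1 : ∫ y in ball x R \ S, ‖w y - w x‖ ∂μ = a ^ p * μ.real (ball x R \ S) := by
      have : ∀ y ∈ ball x R \ S, ‖w y - w x‖ = a ^ p := by
        intro y hy
        have hy' : y ∉ Ω := fun h => hy.2 ⟨h, hy.1⟩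
        have : w y = 0 := by simp [hw, hu0 y hy', Phi]
        rw [this, zero_sub, norm_neg, hw]
        exact norm_Phi hp _
      rw [setIntegral_congr_fun (measurableSet_ball.diff hSm) this]
      simp [mul_comm]
    have h2 : ∫ y in ball x R \ S, ‖w y - w x‖ ∂μ ≤ (1 + p) * R * l * μ.real (ball x R) := 
      (setIntegral_mono_set (hloc _ _ (by fun_prop))
        (Filter.Eventually.of_forall fun _ => norm_nonneg _) 
        (LE.le.eventuallyLE hDB)).trans (hint1 R hR)
    rw [h1] at h2
    have h3 : a ^ p * μ.real (ball x R) ≤ N * ((1 + p) * R * l) * μ.real (ball x R) := by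
      have hN4 : (2:ℝ) ^ (d + 2) ≤ N := by
        rw [hN]; exact pow_le_pow_right₀ (by norm_num) (by omega)
      calc a ^ p * μ.real (ball x R) ≤ a ^ p * (2 ^ (d + 2) * μ.real (ball x R \ S)) := by gcongr
        _ = 2 ^ (d + 2) * (a ^ p * μ.real (ball x R \ S)) := by ring
        _ ≤ 2 ^ (d + 2) * ((1 + p) * R * l * μ.real (ball x R)) := by gcongr
        _ ≤ N * ((1 + p) * R * l * μ.real (ball x R)) := by gcongr
        _ = _ := by ring
    have h4 := le_of_mul_le_mul_right h3 hBpos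
    nlinarith

end
end GNBMO

namespace GNBMO

theorem osc_bdd {n m : ℕ} (Ω : Set (EuclideanSpace ℝ (Fin n)))
    (u : EuclideanSpace ℝ (Fin n) → EuclideanSpace ℝ (Fin m)) (M : ℝ) (hM : ∀ x, ‖u x‖ ≤ M) :
    BddAbove (oscSet Ω u) ∧ 0 ≤ bmoSeminorm Ω u := by
  have hM0 : 0 ≤ M := (norm_nonneg _).trans (hM 0)
  have havg : ∀ {V : Type} [NormedAddCommGroup V] [NormedSpace ℝ V]
      (f : EuclideanSpace ℝ (Fin n) → V) (c : ℝ) (S : Set (EuclideanSpace ℝ (Fin n))),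
      0 ≤ c → volume S < ∞ → (∀ y, ‖f y‖ ≤ c) → ‖⨍ y in S, f y‖ ≤ c := by
    intro V _ _ f c S hc hS hf
    rw [MeasureTheory.setAverage_eq, norm_smul, Real.norm_of_nonneg (by positivity)]
    have h1 := norm_setIntegral_le_of_norm_le_const (f := f) hS (fun y _ => hf y)
    rcases eq_or_lt_of_le (measureReal_nonneg (μ := volume) (s := S)) with h | h
    · rw [← h]; simpa using hc
    · rw [inv_mul_le_iff₀ h]; linarith
  have hfin : ∀ x₀ R, volume (Ω ∩ ball x₀ R) < ∞ := fun x₀ R =>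
    (measure_mono Set.inter_subset_right).trans_lt measure_ball_lt_top
  constructor
  · refine ⟨M + M, ?_⟩
    rintro a ⟨x₀, _, R, _, rfl⟩
    refine (le_abs_self _).trans ?_
    rw [← Real.norm_eq_abs]
    refine havg _ _ _ (by linarith) (hfin _ _) fun y => ?_
    rw [norm_norm]
    refine (norm_sub_le _ _).trans (add_le_add (hM y) ?_)
    exact havg u M _ hM0 (hfin _ _) hM
  · refine Real.sSup_nonneg ?_
    rintro a ⟨x₀, _, R, _, rfl⟩
    rw [MeasureTheory.setAverage_eq]
    exact smul_nonneg (by positivity) (integral_nonneg fun _ => norm_nonneg _)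

end GNBMO

/-- Gagliardo–Nirenberg inequality with BMO norm (constant-weight case):
`∫_Ω |Du|^{2p+2} ≤ C ‖u‖_{BMO(Ω)}² ∫_Ω |Du|^{2p-2} |D²u|²`. -/
theorem gagliardo_nirenberg_bmo (n m : ℕ) (hn : 2 ≤ n) (hm : 1 ≤ m) (p : ℝ) (hp : 1 ≤ p) :
    ∃ C > 0, ∀ (Ω : Set (EuclideanSpace ℝ (Fin n))), IsOpen Ω → Bornology.IsBounded Ω →
      ∀ u : EuclideanSpace ℝ (Fin n) → EuclideanSpace ℝ (Fin m),
        ContDiffOn ℝ 2 u Ω → HasCompactSupport u → tsupport u ⊆ Ω →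
        (∫ x in Ω, ‖fderiv ℝ u x‖ ^ (2 * p + 2)) ≤
          C * bmoNorm Ω u ^ 2 *
            ∫ x in Ω, ‖fderiv ℝ u x‖ ^ (2 * p - 2) * ‖iteratedFDeriv ℝ 2 u x‖ ^ 2 := by
  refine ⟨8 * 4 ^ n * GNBMO.KK n p ^ 2, ?_, ?_⟩
  · have := GNBMO.KK_pos n hp
    positivity
  intro Ω hΩ hΩb u huΩ hcs hts
  have hp0 : 0 ≤ p - 1 := by linarith
  have : Nontrivial (EuclideanSpace ℝ (Fin n)) := by
    have : Nonempty (Fin n) := ⟨⟨0, by omega⟩⟩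
    infer_instance
  have hfr : Module.finrank ℝ (EuclideanSpace ℝ (Fin n)) = n := by simp
  have hu : ContDiff ℝ 2 u := by
    rw [contDiff_iff_contDiffAt]
    intro x
    by_cases hx : x ∈ Ω
    · exact huΩ.contDiffAt (hΩ.mem_nhds hx)
    · have : u =ᶠ[nhds x] 0 := notMem_tsupport_iff_eventuallyEq.1 fun h => hx (hts h)
      exact (contDiffAt_const (c := (0 : EuclideanSpace ℝ (Fin m)))).congr_of_eventuallyEq this
  have hDu : ContDiff ℝ 1 (fderiv ℝ u) := hu.fderiv_right (by norm_num)
  have hDuc : Continuous (fderiv ℝ u) := hDu.continuous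
  have hD2n : Continuous fun y => ‖fderiv ℝ (fderiv ℝ u) y‖ := by
    simp only [GNBMO.norm_D2]
    exact (hu.continuous_iteratedFDeriv (by norm_num)).norm
  have hD1z : ∀ y, y ∉ tsupport u → fderiv ℝ u y = 0 := fun y hy =>
    image_eq_zero_of_notMem_tsupport fun h => hy (tsupport_fderiv_subset ℝ h)
  have hD2z : ∀ y, y ∉ tsupport u → fderiv ℝ (fderiv ℝ u) y = 0 := fun y hy =>
    image_eq_zero_of_notMem_tsupport fun h =>
      hy (tsupport_fderiv_subset ℝ (tsupport_fderiv_subset ℝ h))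
  have hΩz : ∀ y, y ∉ Ω → y ∉ tsupport u := fun y hy h => hy (hts h)
  obtain ⟨M, hM⟩ := hcs.exists_bound_of_continuous hu.continuous
  obtain ⟨hbdd, hsn⟩ := GNBMO.osc_bdd Ω u M hM
  have hL1 : 0 ≤ ∫ x in Ω, ‖u x‖ := integral_nonneg fun _ => norm_nonneg _
  have hB0 : 0 ≤ bmoNorm Ω u := add_nonneg hL1 hsn
  have hSB : bmoSeminorm Ω u ≤ bmoNorm Ω u := by unfold bmoNorm; linarith
  set f : EuclideanSpace ℝ (Fin n) → ℝ := fun y => ‖fderiv ℝ u y‖ ^ (p + 1) with hf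
  set g : EuclideanSpace ℝ (Fin n) → ℝ :=
    fun y => ‖fderiv ℝ u y‖ ^ (p - 1) * ‖fderiv ℝ (fderiv ℝ u) y‖ with hg
  have hfc : Continuous f := hDuc.norm.rpow_const fun _ => Or.inr (by linarith)
  have hgc : Continuous g := (hDuc.norm.rpow_const fun _ => Or.inr hp0).mul hD2n
  have hf0 : ∀ y, 0 ≤ f y := fun y => by positivity
  have hg0 : ∀ y, 0 ≤ g y := fun y => by positivity
  have hfz : ∀ y, y ∉ tsupport u → f y = 0 := fun y hy => by
    simp only [hf, hD1z y hy, norm_zero]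
    exact Real.zero_rpow (by linarith)
  have hgz : ∀ y, y ∉ tsupport u → g y = 0 := fun y hy => by
    have h2 : ‖fderiv ℝ (fderiv ℝ u) y‖ = 0 := by
      rw [hD2z y hy]
      exact ContinuousLinearMap.opNorm_zero
    simp only [hg, h2, mul_zero]
  have hgcs : HasCompactSupport g := HasCompactSupport.intro hcs fun y hy => hgz y hy
  have hf2cs : HasCompactSupport fun y => f y ^ 2 :=
    HasCompactSupport.intro hcs fun y hy => by rw [hfz y hy]; norm_num
  have hg2cs : HasCompactSupport fun y => g y ^ 2 :=
    HasCompactSupport.intro hcs fun y hy => by rw [hgz y hy]; norm_num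
  have hgi : Integrable g := hgc.integrable_of_hasCompactSupport hgcs
  have hf2i : Integrable fun y => f y ^ 2 := (hfc.pow 2).integrable_of_hasCompactSupport hf2cs
  have hg2i : Integrable fun y => g y ^ 2 := (hgc.pow 2).integrable_of_hasCompactSupport hg2cs
  have hosc : ∀ x ∈ Ω, ∀ R > 0, ∃ c, ∫ y in Ω ∩ ball x R, ‖u y - c‖ ≤
      bmoNorm Ω u * volume.real (Ω ∩ ball x R) := by
    intro x hx R hR
    refine ⟨⨍ y in Ω ∩ ball x R, u y, ?_⟩
    have h1 : (⨍ z in Ω ∩ ball x R, ‖u z - ⨍ y in Ω ∩ ball x R, u y‖) ≤ bmoNorm Ω u :=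
      (le_csSup hbdd ⟨x, hx, R, hR, rfl⟩).trans hSB
    rw [← measure_smul_setAverage (fun z => ‖u z - ⨍ y in Ω ∩ ball x R, u y‖)
      ((measure_mono Set.inter_subset_right).trans_lt measure_ball_lt_top).ne, smul_eq_mul, mul_comm]
    gcongr
  have hmain : ∀ ε > 0, ∫ y, f y ^ 2 ≤
      8 * 4 ^ n * (GNBMO.KK n p * (bmoNorm Ω u + ε)) ^ 2 * ∫ y, g y ^ 2 := by
    intro ε hε
    have hb : 0 < bmoNorm Ω u + ε := by linarith
    have hKK := GNBMO.KK_pos n hp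
    have hK : 0 < GNBMO.KK n p * (bmoNorm Ω u + ε) := by positivity
    have hst := GNBMO.strong_type volume f g hfc.measurable hf0 hgc.measurable hgi hg0
      (GNBMO.KK n p * (bmoNorm Ω u + ε)) hK (by
        intro x l hl hmax
        by_cases hx : x ∈ Ω
        · have := GNBMO.pointwise volume hp Ω hΩ.measurableSet u hu
            (fun y hy => hD1z y (hΩz y hy)) x (bmoNorm Ω u + ε) hb
            (fun R hR => by
              obtain ⟨c, hc⟩ := hosc x hx R hR
              refine ⟨c, hc.trans ?_⟩
              gcongr
              linarith) l hl hmax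
          rw [hfr] at this
          exact this
        · rw [hfz x (hΩz x hx)]
          positivity)
    rw [hfr, ← ofReal_integral_eq_lintegral_ofReal hf2i
      (Filter.Eventually.of_forall fun y => by positivity),
      ← ofReal_integral_eq_lintegral_ofReal hg2i
      (Filter.Eventually.of_forall fun y => by positivity),
      ← ENNReal.ofReal_mul (by positivity)] at hst
    have hg2n : 0 ≤ ∫ y, g y ^ 2 := integral_nonneg fun y => by positivity
    exact (ENNReal.ofReal_le_ofReal_iff (by positivity)).1 hst
  have hlim : ∫ y, f y ^ 2 ≤
      8 * 4 ^ n * (GNBMO.KK n p * (bmoNorm Ω u + 0)) ^ 2 * ∫ y, g y ^ 2 := by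
    have hcont : Continuous fun ε : ℝ =>
      8 * 4 ^ n * (GNBMO.KK n p * (bmoNorm Ω u + ε)) ^ 2 * ∫ y, g y ^ 2 := by fun_prop
    refine ge_of_tendsto ((hcont.tendsto 0).mono_left (nhdsWithin_le_nhds (s := Set.Ioi 0))) ?_
    filter_upwards [self_mem_nhdsWithin] with ε hε
    exact hmain ε hε
  have e1 : ∫ x in Ω, ‖fderiv ℝ u x‖ ^ (2 * p + 2) = ∫ y, f y ^ 2 := by
    rw [← setIntegral_eq_integral_of_forall_compl_eq_zero (s := Ω) (f := fun y => f y ^ 2)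
      (fun y hy => by rw [hfz y (hΩz y hy)]; norm_num)]
    congr 1
    ext y
    simp only [hf]
    rw [← Real.rpow_natCast, ← Real.rpow_mul (norm_nonneg _)]
    congr 1
    push_cast
    ring
  have e2 : ∫ x in Ω, ‖fderiv ℝ u x‖ ^ (2 * p - 2) * ‖iteratedFDeriv ℝ 2 u x‖ ^ 2 =
      ∫ y, g y ^ 2 := by
    rw [← setIntegral_eq_integral_of_forall_compl_eq_zero (s := Ω) (f := fun y => g y ^ 2)
      (fun y hy => by rw [hgz y (hΩz y hy)]; norm_num)]
    congr 1
    ext y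
    simp only [hg]
    rw [mul_pow, GNBMO.norm_D2, ← Real.rpow_natCast (‖fderiv ℝ u y‖ ^ (p - 1)),
      ← Real.rpow_mul (norm_nonneg _)]
    congr 2
    push_cast
    ring
  rw [e1, e2]
  refine hlim.trans (le_of_eq ?_)
  rw [add_zero]
  ring
end
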